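/- arXiv:2305.19206 — 2 statements merged into one kernel-verified Lean document; each statement's English description precedes it below -/
import Mathlib

section
/- Assume λ₁* > 0 and η ≤ 1/(12·λ₁*). If X_t ∈ R₂ for some t ≥ 0, then X_{t'} ∈ R₂ for all t' ≥ t; that is, R₂ is an absorbing region for the gradient descent iteration. -/
open Matrix

/-- The largest singular value of a real matrix. -/
noncomputable def sigmaMax {m n : ℕ} (M : Matrix (Fin m) (Fin n) ℝ) : ℝ :=
  sSup {c : ℝ | ∃ v : EuclideanSpace ℝ (Fin n), ‖v‖ = 1 ∧
    c = ‖(EuclideanSpace.equiv (Fin m) ℝ).symm (M.mulVec ((EuclideanSpace.equiv (Fin n) ℝ) v))‖}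

/-- The smallest singular value (the `n`-th largest, for a matrix with `n` columns). -/
noncomputable def sigmaMin {m n : ℕ} (M : Matrix (Fin m) (Fin n) ℝ) : ℝ :=
  sInf {c : ℝ | ∃ v : EuclideanSpace ℝ (Fin n), ‖v‖ = 1 ∧
    c = ‖(EuclideanSpace.equiv (Fin m) ℝ).symm (M.mulVec ((EuclideanSpace.equiv (Fin n) ℝ) v))‖}

/-- Frobenius norm of a real matrix. -/
noncomputable def frobNorm {m n : ℕ} (M : Matrix (Fin m) (Fin n) ℝ) : ℝ :=
  Real.sqrt (∑ i, ∑ j, (M i j) ^ 2)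

/-- Gradient descent iterates `X_{t+1} = X_t + η (Σ - X_t X_tᵀ) X_t`. -/
noncomputable def gdIter {d r : ℕ} (S : Matrix (Fin d) (Fin d) ℝ) (η : ℝ)
    (X0 : Matrix (Fin d) (Fin r) ℝ) : ℕ → Matrix (Fin d) (Fin r) ℝ
  | 0 => X0
  | t + 1 => gdIter S η X0 t +
      η • ((S - gdIter S η X0 t * (gdIter S η X0 t)ᵀ) * gdIter S η X0 t)

/-- The top `r × r` block `U` (first `r` rows) of `X ∈ ℝ^{d×r}`. -/
def topBlock {d r : ℕ} (h : r ≤ d) (X : Matrix (Fin d) (Fin r) ℝ) :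
    Matrix (Fin r) (Fin r) ℝ :=
  fun i j => X (Fin.castLE h i) j

/-- The bottom `(d-r) × r` block `J` (last `d-r` rows) of `X ∈ ℝ^{d×r}`. -/
def botBlock {d r : ℕ} (X : Matrix (Fin d) (Fin r) ℝ) :
    Matrix (Fin (d - r)) (Fin r) ℝ :=
  fun i j => X ⟨r + (i : ℕ), by have := i.isLt; omega⟩ j

/-- The region `R = {X : σ₁(X)² ≤ 2λ₁*, σ₁(J)² ≤ λ_r* − Δ/2, σ_r(U)² ≥ Δ/4}`. -/
def inR {d r : ℕ} (h : r ≤ d) (lam1 lamr Δ : ℝ) (X : Matrix (Fin d) (Fin r) ℝ) : Prop :=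
  sigmaMax X ^ 2 ≤ 2 * lam1 ∧ sigmaMax (botBlock X) ^ 2 ≤ lamr - Δ / 2 ∧
    Δ / 4 ≤ sigmaMin (topBlock h X) ^ 2

/-- The region `R₂ = {X : σ₁(X)² ≤ 2λ₁*, σ₁(J)² ≤ λ_r* − Δ/2}`. -/
def inR2 {d r : ℕ} (lam1 lamr Δ : ℝ) (X : Matrix (Fin d) (Fin r) ℝ) : Prop :=
  sigmaMax X ^ 2 ≤ 2 * lam1 ∧ sigmaMax (botBlock X) ^ 2 ≤ lamr - Δ / 2


/-- Squared Euclidean norm as a dot product. -/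
lemma norm_toLp_sq {n : ℕ} (x : Fin n → ℝ) : ‖WithLp.toLp 2 x‖ ^ 2 = x ⬝ᵥ x := by
  rw [EuclideanSpace.norm_sq_eq]
  simp [dotProduct, sq]

lemma dotProduct_self_add_le {n : ℕ} {x y : Fin n → ℝ} {α β V : ℝ} (hα : 0 ≤ α) (hβ : 0 ≤ β)
    (hV : 0 ≤ V) (hx : x ⬝ᵥ x ≤ α ^ 2 * V) (hy : y ⬝ᵥ y ≤ β ^ 2 * V) :
    (x + y) ⬝ᵥ (x + y) ≤ (α + β) ^ 2 * V := by
  rw [← norm_toLp_sq] at hx hy ⊢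
  have key : ∀ {a : ℝ}, 0 ≤ a → a ^ 2 * V = (a * √V) ^ 2 := fun _ => by
    rw [mul_pow, Real.sq_sqrt hV]
  rw [key hα] at hx
  rw [key hβ] at hy
  rw [key (add_nonneg hα hβ)]
  have hx' := abs_le_of_sq_le_sq' hx (by positivity)
  have hy' := abs_le_of_sq_le_sq' hy (by positivity)
  have h := norm_add_le (WithLp.toLp 2 x) (WithLp.toLp 2 y)
  rw [← WithLp.toLp_add] at h
  exact pow_le_pow_left₀ (norm_nonneg _) (by linarith [hx'.2, hy'.2]) 2

lemma sigmaMax_sq_le_iff {m n : ℕ} (M : Matrix (Fin m) (Fin n) ℝ) {b : ℝ} (hb : 0 ≤ b) :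
    sigmaMax M ^ 2 ≤ b ↔ ∀ v, (M *ᵥ v) ⬝ᵥ (M *ᵥ v) ≤ b * (v ⬝ᵥ v) := by
  have hnn : 0 ≤ sigmaMax M := Real.sSup_nonneg (by rintro _ ⟨v, -, rfl⟩; positivity)
  constructor
  · intro h v
    by_cases hv : v = 0
    · simp [hv]
    have hbdd : BddAbove {c : ℝ | ∃ v : EuclideanSpace ℝ (Fin n), ‖v‖ = 1 ∧
        c = ‖(EuclideanSpace.equiv (Fin m) ℝ).symm
          (M.mulVec ((EuclideanSpace.equiv (Fin n) ℝ) v))‖} := by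
      refine ⟨‖M.toEuclideanLin.toContinuousLinearMap‖, ?_⟩
      rintro _ ⟨w, hw, rfl⟩
      have := M.toEuclideanLin.toContinuousLinearMap.le_opNorm w
      rw [hw, mul_one] at this
      exact this
    set N := ‖WithLp.toLp 2 v‖ with hN
    have hNpos : 0 < N := by
      rw [hN, norm_pos_iff]
      simpa using hv
    have hmem : N⁻¹ * ‖WithLp.toLp 2 (M *ᵥ v)‖ ≤ sigmaMax M := by
      refine le_csSup hbdd ⟨WithLp.toLp 2 (N⁻¹ • v), ?_, ?_⟩
      · rw [WithLp.toLp_smul, norm_smul, norm_inv, Real.norm_of_nonneg hNpos.le]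
        exact inv_mul_cancel₀ hNpos.ne'
      · change _ = ‖WithLp.toLp 2 (M *ᵥ (N⁻¹ • v))‖
        rw [mulVec_smul, WithLp.toLp_smul, norm_smul, norm_inv, Real.norm_of_nonneg hNpos.le]
    rw [← norm_toLp_sq, ← norm_toLp_sq, ← hN]
    rw [inv_mul_le_iff₀ hNpos] at hmem
    calc _ ≤ (N * sigmaMax M) ^ 2 := pow_le_pow_left₀ (norm_nonneg _) hmem 2
      _ = sigmaMax M ^ 2 * N ^ 2 := by ring
      _ ≤ b * N ^ 2 := by gcongr
  · intro h
    have hle : sigmaMax M ≤ √b := by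
      refine Real.sSup_le ?_ (Real.sqrt_nonneg _)
      rintro _ ⟨v, hv, rfl⟩
      refine Real.le_sqrt_of_sq_le ?_
      change ‖WithLp.toLp 2 (M *ᵥ v.ofLp)‖ ^ 2 ≤ b
      have := h v.ofLp
      rw [← norm_toLp_sq, ← norm_toLp_sq] at this
      simpa [hv] using this
    calc _ ≤ √b ^ 2 := pow_le_pow_left₀ hnn hle 2
      _ = b := Real.sq_sqrt hb

lemma dotProduct_self_nonneg_real {n : ℕ} (x : Fin n → ℝ) : 0 ≤ x ⬝ᵥ x :=
  Finset.sum_nonneg fun _ _ => mul_self_nonneg _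

/-- On `[0, √b]` the map `s ↦ c s - η s³` is increasing, so it can be bounded at `√b`. -/
lemma cubic_mulVec_le {m n : ℕ} {A : Matrix (Fin m) (Fin n) ℝ} {b c η : ℝ}
    (hA : ∀ v, (A *ᵥ v) ⬝ᵥ (A *ᵥ v) ≤ b * (v ⬝ᵥ v)) (hb : 0 ≤ b) (hη : 0 ≤ η)
    (hc : 3 * η * b ≤ c) (v : Fin n → ℝ) :
    (A *ᵥ (c • v - η • (Aᵀ *ᵥ (A *ᵥ v)))) ⬝ᵥ (A *ᵥ (c • v - η • (Aᵀ *ᵥ (A *ᵥ v))))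
      ≤ (c - η * b) ^ 2 * (b * (v ⬝ᵥ v)) := by
  set z := Aᵀ *ᵥ (A *ᵥ v)
  have h1 : v ⬝ᵥ z = (A *ᵥ v) ⬝ᵥ (A *ᵥ v) := dotProduct_transpose_mulVec A v _
  have h2 : z ⬝ᵥ z = (A *ᵥ z) ⬝ᵥ (A *ᵥ v) :=
    (dotProduct_transpose_mulVec A z _).trans (dotProduct_comm _ _)
  have q0 := hA v
  have q1 : 0 ≤ (b • v - z) ⬝ᵥ (b • v - z) := dotProduct_self_nonneg_real _
  have q2 := hA (b • v - z)
  have c1 := dotProduct_comm z v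
  have c2 := dotProduct_comm (A *ᵥ z) (A *ᵥ v)
  simp only [mulVec_sub, mulVec_smul, dotProduct_sub, sub_dotProduct, smul_dotProduct,
    dotProduct_smul, smul_eq_mul] at q1 q2 ⊢
  rw [c1] at q1 q2
  rw [← c2] at q2 ⊢
  rw [← h2, ← h1] at q2 ⊢
  rw [← h1] at q0
  have hηb : 0 ≤ η * b := by positivity
  have p0 : 0 ≤ (c - η * b) * (c - 3 * η * b) := mul_nonneg (by linarith) (by linarith)
  have p1 : 0 ≤ η * (2 * c - 3 * η * b) := mul_nonneg hη (by linarith)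
  have t0 := mul_nonneg p0 (sub_nonneg.2 q0)
  have t1 := mul_nonneg p1 q1
  have t2 := mul_nonneg (sq_nonneg η) (sub_nonneg.2 q2)
  linarith

lemma half_sub_gram_mulVec_le {k n : ℕ} {U : Matrix (Fin k) (Fin n) ℝ} {c η : ℝ}
    (hU : ∀ v, (U *ᵥ v) ⬝ᵥ (U *ᵥ v) ≤ c * (v ⬝ᵥ v)) (hη : 0 ≤ η)
    (hc : η * c ≤ 1) (v : Fin n → ℝ) :
    ((1 / 2 : ℝ) • v - η • (Uᵀ *ᵥ (U *ᵥ v))) ⬝ᵥ ((1 / 2 : ℝ) • v - η • (Uᵀ *ᵥ (U *ᵥ v)))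
      ≤ (1 / 2) ^ 2 * (v ⬝ᵥ v) := by
  set z := Uᵀ *ᵥ (U *ᵥ v)
  have h1 : v ⬝ᵥ z = (U *ᵥ v) ⬝ᵥ (U *ᵥ v) := dotProduct_transpose_mulVec U v _
  have h2 : z ⬝ᵥ z = (U *ᵥ z) ⬝ᵥ (U *ᵥ v) :=
    (dotProduct_transpose_mulVec U z _).trans (dotProduct_comm _ _)
  have c1 := dotProduct_comm z v
  have c2 := dotProduct_comm (U *ᵥ z) (U *ᵥ v)
  have q : 0 ≤ (U *ᵥ (v - η • z)) ⬝ᵥ (U *ᵥ (v - η • z)) := dotProduct_self_nonneg_real _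
  have qz := hU z
  have z0 : 0 ≤ z ⬝ᵥ z := dotProduct_self_nonneg_real _
  simp only [mulVec_sub, mulVec_smul, dotProduct_sub, sub_dotProduct, smul_dotProduct,
    dotProduct_smul, smul_eq_mul] at q ⊢
  rw [← c2, ← h2, ← h1] at q
  rw [c1]
  have t0 := mul_le_mul_of_nonneg_left qz (sq_nonneg η)
  have t1 := mul_le_mul_of_nonneg_right hc (mul_nonneg hη z0)
  have t2 := mul_nonneg hη (show 0 ≤ v ⬝ᵥ z - η * (z ⬝ᵥ z) by linarith)
  linarith

lemma diagonal_mulVec_dotProduct_le {m : ℕ} {D : Fin m → ℝ} {l : ℝ} (hD : ∀ i, 0 ≤ D i)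
    (hDl : ∀ i, D i ≤ l) (x : Fin m → ℝ) :
    (diagonal D *ᵥ x) ⬝ᵥ (diagonal D *ᵥ x) ≤ l ^ 2 * (x ⬝ᵥ x) := by
  simp only [dotProduct, mulVec_diagonal, Finset.mul_sum]
  refine Finset.sum_le_sum fun i _ => ?_
  have := pow_le_pow_left₀ (hD i) (hDl i) 2
  calc _ = D i ^ 2 * (x i * x i) := by ring
    _ ≤ _ := mul_le_mul_of_nonneg_right this (mul_self_nonneg _)

/-- One gradient step on a block of rows `A`, the other rows being `U`, preserves the bound
`σ₁(A)² ≤ b`. -/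
lemma gradient_step_le {m k n : ℕ} {A : Matrix (Fin m) (Fin n) ℝ} {U : Matrix (Fin k) (Fin n) ℝ}
    {D : Fin m → ℝ} {l b c η : ℝ} (hD : ∀ i, 0 ≤ D i) (hDl : ∀ i, D i ≤ l) (hl : 0 ≤ l)
    (hlb : l ≤ b) (hη : 0 ≤ η) (hηb : 6 * η * b ≤ 1) (hηc : η * c ≤ 1)
    (hA : ∀ v, (A *ᵥ v) ⬝ᵥ (A *ᵥ v) ≤ b * (v ⬝ᵥ v))
    (hU : ∀ v, (U *ᵥ v) ⬝ᵥ (U *ᵥ v) ≤ c * (v ⬝ᵥ v)) (v : Fin n → ℝ) :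
    ((A + η • (diagonal D * A - A * (Aᵀ * A + Uᵀ * U))) *ᵥ v) ⬝ᵥ
      ((A + η • (diagonal D * A - A * (Aᵀ * A + Uᵀ * U))) *ᵥ v) ≤ b * (v ⬝ᵥ v) := by
  have hb : 0 ≤ b := hl.trans hlb
  have hv : 0 ≤ v ⬝ᵥ v := dotProduct_self_nonneg_real _
  have hV : 0 ≤ b * (v ⬝ᵥ v) := mul_nonneg hb hv
  have hsplit : (A + η • (diagonal D * A - A * (Aᵀ * A + Uᵀ * U))) *ᵥ v =
      η • (diagonal D *ᵥ (A *ᵥ v)) + A *ᵥ ((1 / 2 : ℝ) • v - η • (Aᵀ *ᵥ (A *ᵥ v)))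
        + A *ᵥ ((1 / 2 : ℝ) • v - η • (Uᵀ *ᵥ (U *ᵥ v))) := by
    simp only [add_mulVec, smul_mulVec, sub_mulVec, ← mulVec_mulVec, mulVec_sub, mulVec_smul,
      mulVec_add]
    module
  have e1 : (η • (diagonal D *ᵥ (A *ᵥ v))) ⬝ᵥ (η • (diagonal D *ᵥ (A *ᵥ v)))
      ≤ (η * l) ^ 2 * (b * (v ⬝ᵥ v)) := by
    simp only [smul_dotProduct, dotProduct_smul, smul_eq_mul]
    have := (diagonal_mulVec_dotProduct_le hD hDl (A *ᵥ v)).trans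
      (mul_le_mul_of_nonneg_left (hA v) (sq_nonneg l))
    have := mul_le_mul_of_nonneg_left this (sq_nonneg η)
    linarith
  have e2 := cubic_mulVec_le hA hb hη (c := 1 / 2) (by linarith) v
  have e3 : _ ≤ (1 / 2 : ℝ) ^ 2 * (b * (v ⬝ᵥ v)) :=
    (hA ((1 / 2 : ℝ) • v - η • (Uᵀ *ᵥ (U *ᵥ v)))).trans <| by
      have := mul_le_mul_of_nonneg_left (half_sub_gram_mulVec_le hU hη hηc v) hb
      linarith
  have hηb0 : 0 ≤ η * b := by positivity
  have hηl : 0 ≤ η * l := by positivity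
  have hηlb : η * l ≤ η * b := by gcongr
  rw [hsplit]
  refine (dotProduct_self_add_le (by linarith) (by norm_num) hV
    (dotProduct_self_add_le hηl (by linarith) hV e1 e2) e3).trans ?_
  refine mul_le_of_le_one_left hV (pow_le_one₀ (by linarith) (by linarith))

lemma sum_top_add_sum_bot {d r : ℕ} (h : r ≤ d) (f : Fin d → ℝ) :
    ∑ i, f i = ∑ i : Fin r, f (Fin.castLE h i) +
      ∑ i : Fin (d - r), f ⟨r + (i : ℕ), by have := i.isLt; omega⟩ := by
  rw [← Equiv.sum_comp (finSumFinEquiv.trans (finCongr (Nat.add_sub_cancel' h))) f,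
    Fintype.sum_sum_type]
  rfl

lemma transpose_mul_self_eq_blocks {d r : ℕ} (h : r ≤ d) (X : Matrix (Fin d) (Fin r) ℝ) :
    Xᵀ * X = (botBlock X)ᵀ * botBlock X + (topBlock h X)ᵀ * topBlock h X := by
  ext i j
  simp only [mul_apply, Matrix.add_apply, transpose_apply]
  rw [sum_top_add_sum_bot h, add_comm]
  rfl

lemma topBlock_mulVec_dotProduct_le {d r : ℕ} (h : r ≤ d) (X : Matrix (Fin d) (Fin r) ℝ)
    (v : Fin r → ℝ) :
    (topBlock h X *ᵥ v) ⬝ᵥ (topBlock h X *ᵥ v) ≤ (X *ᵥ v) ⬝ᵥ (X *ᵥ v) := by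
  have : (X *ᵥ v) ⬝ᵥ (X *ᵥ v) = (topBlock h X *ᵥ v) ⬝ᵥ (topBlock h X *ᵥ v) +
      (botBlock X *ᵥ v) ⬝ᵥ (botBlock X *ᵥ v) := sum_top_add_sum_bot h _
  rw [this]
  exact le_add_of_nonneg_right (dotProduct_self_nonneg_real _)

lemma botBlock_gradient_step {d r : ℕ} (h : r ≤ d) (lam : Fin d → ℝ) (η : ℝ)
    (X : Matrix (Fin d) (Fin r) ℝ) :
    botBlock (X + η • ((diagonal lam - X * Xᵀ) * X)) =
      botBlock X + η • (diagonal (fun i : Fin (d - r) =>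
          lam ⟨r + (i : ℕ), by have := i.isLt; omega⟩) * botBlock X -
        botBlock X * ((botBlock X)ᵀ * botBlock X + (topBlock h X)ᵀ * topBlock h X)) := by
  rw [← transpose_mul_self_eq_blocks, Matrix.sub_mul, Matrix.mul_assoc]
  ext i j
  simp only [botBlock, Matrix.add_apply, Matrix.smul_apply, Matrix.sub_apply, diagonal_mul]
  rfl

/-- Lemma 3.1: `R₂` is an absorbing region for gradient descent. -/
theorem R2_absorbing (d r : ℕ) (hr : 0 < r) (hrd : r < d)
    (lam : Fin d → ℝ)
    (hmono : ∀ i j : Fin d, i ≤ j → lam j ≤ lam i)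
    (hnn : ∀ i, 0 ≤ lam i)
    (hlam1 : 0 < lam ⟨0, by omega⟩)
    (η : ℝ) (hη : 0 < η)
    (hηle : η ≤ 1 / (12 * lam ⟨0, by omega⟩))
    (X0 : Matrix (Fin d) (Fin r) ℝ) (t : ℕ)
    (ht : inR2 (lam ⟨0, by omega⟩) (lam ⟨r - 1, by omega⟩)
      (lam ⟨r - 1, by omega⟩ - lam ⟨r, hrd⟩) (gdIter (Matrix.diagonal lam) η X0 t)) :
    ∀ t' : ℕ, t ≤ t' →
      inR2 (lam ⟨0, by omega⟩) (lam ⟨r - 1, by omega⟩)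
        (lam ⟨r - 1, by omega⟩ - lam ⟨r, hrd⟩) (gdIter (Matrix.diagonal lam) η X0 t') := by
  have hL := hlam1
  rw [le_div_iff₀ (by positivity)] at hηle
  have hr1 : lam ⟨r - 1, by omega⟩ ≤ lam ⟨0, by omega⟩ := hmono _ _ (Fin.mk_le_mk.2 (by omega))
  have hr2 : lam ⟨r, hrd⟩ ≤ lam ⟨r - 1, by omega⟩ := hmono _ _ (Fin.mk_le_mk.2 (by omega))
  have hr3 : 0 ≤ lam ⟨r, hrd⟩ := hnn _
  set L := lam ⟨0, by omega⟩
  set a := lam ⟨r - 1, by omega⟩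
  set l := lam ⟨r, hrd⟩
  intro t' htt'
  induction t', htt' using Nat.le_induction with
  | base => exact ht
  | succ s _ ih =>
    obtain ⟨h1, h2⟩ := ih
    have hb : 0 ≤ a - (a - l) / 2 := by linarith
    rw [sigmaMax_sq_le_iff _ (by positivity)] at h1
    rw [sigmaMax_sq_le_iff _ hb] at h2
    rw [inR2, sigmaMax_sq_le_iff _ (by positivity), sigmaMax_sq_le_iff _ hb, gdIter]
    set X := gdIter (diagonal lam) η X0 s
    constructor
    · have := gradient_step_le (A := X) (U := (0 : Matrix (Fin 0) (Fin r) ℝ)) (D := lam)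
        (l := L) (b := 2 * L) (c := 0) (η := η) hnn
        (fun i => hmono _ _ (Fin.mk_le_mk.2 (Nat.zero_le _))) hL.le (by linarith) hη.le
        (by linarith) (by simp) h1 (by simp)
      simpa [Matrix.sub_mul, Matrix.mul_assoc] using this
    · rw [botBlock_gradient_step hrd.le]
      have hηb : η * (a - (a - l) / 2) ≤ η * L := mul_le_mul_of_nonneg_left (by linarith) hη.le
      exact gradient_step_le (l := l) (c := 2 * L) (fun i => hnn _)
        (fun i => hmono _ _ (Fin.mk_le_mk.2 (Nat.le_add_right _ _))) hr3 (by linarith) hη.le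
        (by linarith [mul_pos hη hL]) (by linarith [mul_pos hη hL]) h2
        (fun v => (topBlock_mulVec_dotProduct_le hrd.le X v).trans (h1 v))
end

section
/- Assume Δ > 0 and η ≤ Δ²/(36·λ₁*³). Let κ = log(1 + η·λ_{r+1}*)/log(1 + η·(λ_r* − Δ/2)) and c₁ = Δ^{1−κ/2}/(2^{3−κ}·√λ₁*). Suppose the initialization satisfies σ₁(X₀)² ≤ λ₁*, σ₁(J₀)² ≤ λ_r* − Δ/2, 0 < σ_r(U₀)² < Δ/4, and σ₁(J₀)² ≤ c₁·σ_r(U₀)^{1+κ}. Then there exists an absolute constant C > 0 such that for every ε > 0 and every t ≥ C·((1/(ηΔ))·log(Δ/(4·σ_r(U₀)²)) + (1/(ηΔ))·log(200·r·λ₁*²/(η·Δ²·ε))), the iterate satisfies ‖Σ_r − X_t X_tᵀ‖_F ≤ ε. -/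
open Matrix

section Operators

open scoped RealInnerProductSpace InnerProductSpace

variable {E F : Type*} [NormedAddCommGroup E] [InnerProductSpace ℝ E]
  [NormedAddCommGroup F] [InnerProductSpace ℝ F]

theorem norm_sq_apply_le_of_symm_of_bounds {G : E →L[ℝ] E} {L : ℝ} (hL : 0 < L)
    (hs : ∀ x y, ⟪G x, y⟫_ℝ = ⟪x, G y⟫_ℝ) (h0 : ∀ v, 0 ≤ ⟪G v, v⟫_ℝ)
    (hG : ∀ v, ⟪G v, v⟫_ℝ ≤ L * ‖v‖ ^ 2) (v : E) :
    ‖G v‖ ^ 2 ≤ L * ⟪G v, v⟫_ℝ := by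
  have h1 := h0 (L • v - G v)
  have h2 := hG (G v)
  have h3 : ⟪G (G v), v⟫_ℝ = ‖G v‖ ^ 2 := by rw [hs, real_inner_self_eq_norm_sq]
  simp only [map_sub, map_smul, inner_sub_left, inner_sub_right, inner_smul_left,
    inner_smul_right, h3, real_inner_self_eq_norm_sq, conj_trivial] at h1
  have h4 : 0 ≤ L * (L * ⟪G v, v⟫_ℝ - ‖G v‖ ^ 2) := by linarith
  have := (mul_nonneg_iff_of_pos_left hL).1 h4
  linarith

theorem inner_apply_sub_smul {G : E →L[ℝ] E} (η : ℝ)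
    (hs : ∀ x y, ⟪G x, y⟫_ℝ = ⟪x, G y⟫_ℝ) (v : E) :
    ⟪G (v - η • G v), v - η • G v⟫_ℝ =
      ⟪G v, v⟫_ℝ - 2 * η * ‖G v‖ ^ 2 + η ^ 2 * ⟪G (G v), G v⟫_ℝ := by
  have h3 : ⟪G (G v), v⟫_ℝ = ‖G v‖ ^ 2 := by rw [hs, real_inner_self_eq_norm_sq]
  simp only [map_sub, map_smul, inner_sub_left, inner_sub_right, inner_smul_left,
    inner_smul_right, h3, real_inner_self_eq_norm_sq, conj_trivial]
  ring

theorem norm_sq_sub_smul {G : E →L[ℝ] E} (η : ℝ) (v : E) :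
    ‖v - η • G v‖ ^ 2 = ‖v‖ ^ 2 - 2 * η * ⟪G v, v⟫_ℝ + η ^ 2 * ‖G v‖ ^ 2 := by
  rw [norm_sub_sq_real, inner_smul_right, norm_smul, mul_pow, Real.norm_eq_abs, sq_abs,
    real_inner_comm]
  ring

theorem inner_apply_sub_smul_lower {G : E →L[ℝ] E} {L η μ : ℝ} (hL : 0 < L) (hη : 0 ≤ η)
    (hηL : 6 * (η * L) ≤ 1) (hμ : 0 ≤ μ) (hμL : μ ≤ L)
    (hs : ∀ x y, ⟪G x, y⟫_ℝ = ⟪x, G y⟫_ℝ) (h0 : ∀ v, μ * ‖v‖ ^ 2 ≤ ⟪G v, v⟫_ℝ)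
    (hG : ∀ v, ⟪G v, v⟫_ℝ ≤ L * ‖v‖ ^ 2) (v : E) :
    μ * (1 - 2 * η * μ) * ‖v‖ ^ 2 ≤ ⟪G (v - η • G v), v - η • G v⟫_ℝ := by
  rw [inner_apply_sub_smul η hs]
  have hp : 0 ≤ ⟪G (G v), G v⟫_ℝ := (by positivity : 0 ≤ μ * ‖G v‖ ^ 2).trans (h0 _)
  have hN := norm_sq_apply_le_of_symm_of_bounds (G := G - μ • ContinuousLinearMap.id ℝ E) hL
    (fun x y => by
      simp [inner_sub_left, inner_sub_right, inner_smul_left, inner_smul_right, hs])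
    (fun v => by
      have := h0 v
      simp only [_root_.sub_apply, _root_.smul_apply,
        ContinuousLinearMap.id_apply, inner_sub_left, inner_smul_left, conj_trivial,
        real_inner_self_eq_norm_sq]
      linarith)
    (fun v => by
      have := hG v
      have : 0 ≤ μ * ‖v‖ ^ 2 := by positivity
      simp only [_root_.sub_apply, _root_.smul_apply,
        ContinuousLinearMap.id_apply, inner_sub_left, inner_smul_left, conj_trivial,
        real_inner_self_eq_norm_sq]
      linarith) v
  simp only [_root_.sub_apply, _root_.smul_apply,
    ContinuousLinearMap.id_apply, inner_sub_left, inner_smul_left, conj_trivial,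
    real_inner_self_eq_norm_sq] at hN
  rw [norm_sub_sq_real, inner_smul_right, norm_smul, mul_pow, Real.norm_eq_abs, sq_abs] at hN
  have h1 := h0 v
  set g := ⟪G v, v⟫_ℝ
  have h2 : 2 * η * ‖G v‖ ^ 2 ≤
      2 * η * (L * (g - μ * ‖v‖ ^ 2) + 2 * (μ * g) - μ ^ 2 * ‖v‖ ^ 2) := by
    gcongr; linarith
  have h3 : 0 ≤ (1 - 4 * (η * μ) - 2 * (η * L)) * (g - μ * ‖v‖ ^ 2) := by
    have : η * μ ≤ η * L := by gcongr
    apply mul_nonneg <;> linarith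
  have h4 : 0 ≤ η ^ 2 * ⟪G (G v), G v⟫_ℝ := by positivity
  nlinarith

theorem inner_apply_sub_smul_upper {G : E →L[ℝ] E} {L η : ℝ} (hL : 0 < L) (hη : 0 ≤ η)
    (hηL : 6 * (η * L) ≤ 1)
    (hs : ∀ x y, ⟪G x, y⟫_ℝ = ⟪x, G y⟫_ℝ)
    (hG : ∀ v, ⟪G v, v⟫_ℝ ≤ L * ‖v‖ ^ 2) (v : E) :
    ⟪G (v - η • G v), v - η • G v⟫_ℝ ≤ L * (1 - η * L) ^ 2 * ‖v‖ ^ 2 := by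
  rw [inner_apply_sub_smul η hs]
  rcases eq_or_ne v 0 with rfl | hv
  · simp
  have hn : 0 < ‖v‖ ^ 2 := by positivity
  have h1 := hG v
  have h2 := hG (G v)
  have h3 : ⟪G v, v⟫_ℝ ^ 2 ≤ ‖G v‖ ^ 2 * ‖v‖ ^ 2 := by
    rw [← mul_pow]
    exact sq_le_sq' (by linarith [neg_le_of_abs_le (abs_real_inner_le_norm (G v) v)])
      (real_inner_le_norm _ _)
  set g := ⟪G v, v⟫_ℝ
  set n := ‖v‖ ^ 2
  set m := ‖G v‖ ^ 2
  have hc : 0 ≤ 2 * η - η ^ 2 * L := by nlinarith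
  have h4 : η ^ 2 * ⟪G (G v), G v⟫_ℝ ≤ η ^ 2 * (L * m) := by gcongr
  refine le_of_mul_le_mul_right ?_ hn
  have h5 : (2 * η - η ^ 2 * L) * g ^ 2 ≤ (2 * η - η ^ 2 * L) * (m * n) := by gcongr
  have h6 : (g - 2 * η * m + η ^ 2 * ⟪G (G v), G v⟫_ℝ) * n ≤
      (g - 2 * η * m + η ^ 2 * (L * m)) * n := by gcongr
  have h7 : 0 ≤ (L * n - g) * (n - (2 * η - η ^ 2 * L) * (L * n + g)) := by
    apply mul_nonneg (by linarith)
    have : (2 * η - η ^ 2 * L) * (L * n + g) ≤ (2 * η) * (L * n + L * n) := by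
      calc _ ≤ (2 * η - η ^ 2 * L) * (L * n + L * n) := by gcongr
        _ ≤ _ := by gcongr; nlinarith [sq_nonneg η]
    nlinarith
  nlinarith

theorem norm_sq_sub_smul_le {G : E →L[ℝ] E} {L η μ : ℝ} (hL : 0 < L) (hη : 0 ≤ η)
    (hηL : η * L ≤ 1) (hμ : 0 ≤ μ)
    (hs : ∀ x y, ⟪G x, y⟫_ℝ = ⟪x, G y⟫_ℝ) (h0 : ∀ v, μ * ‖v‖ ^ 2 ≤ ⟪G v, v⟫_ℝ)
    (hG : ∀ v, ⟪G v, v⟫_ℝ ≤ L * ‖v‖ ^ 2) (v : E) :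
    ‖v - η • G v‖ ^ 2 ≤ (1 - (2 - η * L) * (η * μ)) * ‖v‖ ^ 2 := by
  rw [norm_sq_sub_smul]
  have h1 := norm_sq_apply_le_of_symm_of_bounds hL hs
    (fun v => (by positivity : 0 ≤ μ * ‖v‖ ^ 2).trans (h0 v)) hG v
  have h2 : η ^ 2 * ‖G v‖ ^ 2 ≤ η ^ 2 * (L * ⟪G v, v⟫_ℝ) := by gcongr
  have h3 : (2 - η * L) * η * (μ * ‖v‖ ^ 2) ≤ (2 - η * L) * η * ⟪G v, v⟫_ℝ := by
    have : 0 ≤ 2 - η * L := by linarith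
    gcongr
    exact h0 v
  nlinarith

variable [CompleteSpace E] [CompleteSpace F]

/-- `Uᵀ U + Jᵀ J` -/
noncomputable def stackedGram (U : E →L[ℝ] E) (J : E →L[ℝ] F) : E →L[ℝ] E :=
  U.adjoint ∘L U + J.adjoint ∘L J

theorem inner_stackedGram (U : E →L[ℝ] E) (J : E →L[ℝ] F) (v w : E) :
    ⟪stackedGram U J v, w⟫_ℝ = ⟪U v, U w⟫_ℝ + ⟪J v, J w⟫_ℝ := by
  simp [stackedGram, inner_add_left, ContinuousLinearMap.adjoint_inner_left]

theorem stackedGram_symm (U : E →L[ℝ] E) (J : E →L[ℝ] F) (v w : E) :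
    ⟪stackedGram U J v, w⟫_ℝ = ⟪v, stackedGram U J w⟫_ℝ := by
  rw [inner_stackedGram, real_inner_comm _ v, inner_stackedGram, real_inner_comm (U v),
    real_inner_comm (J v)]

theorem inner_stackedGram_self (U : E →L[ℝ] E) (J : E →L[ℝ] F) (v : E) :
    ⟪stackedGram U J v, v⟫_ℝ = ‖U v‖ ^ 2 + ‖J v‖ ^ 2 := by
  rw [inner_stackedGram, real_inner_self_eq_norm_sq, real_inner_self_eq_norm_sq]

/-- One gradient step for a block of rows `Y`, where `G` is the Gram matrix of all the rows. -/
noncomputable def blockStep (Λ : F →L[ℝ] F) (η : ℝ) (G : E →L[ℝ] E) (Y : E →L[ℝ] F) :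
    E →L[ℝ] F :=
  Y + η • (Λ ∘L Y - Y ∘L G)

omit [CompleteSpace E] [CompleteSpace F] in
theorem blockStep_apply (Λ : F →L[ℝ] F) (η : ℝ) (G : E →L[ℝ] E) (Y : E →L[ℝ] F) (v : E) :
    blockStep Λ η G Y v = Y (v - η • G v) + η • Λ (Y v) := by
  simp only [blockStep, _root_.add_apply, _root_.smul_apply,
    _root_.sub_apply, ContinuousLinearMap.comp_apply, map_sub, map_smul]
  module

omit [CompleteSpace E] [CompleteSpace F] in
theorem blockStep_apply' (Λ : F →L[ℝ] F) (η : ℝ) (G : E →L[ℝ] E) (Y : E →L[ℝ] F) (v : E) :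
    blockStep Λ η G Y v = (Y (v - η • G v) + η • Λ (Y (v - η • G v))) + η ^ 2 • Λ (Y (G v)) := by
  rw [blockStep_apply]
  simp only [map_sub, map_smul]
  module

/-- The spectral and step-size assumptions: `Λ₁` has spectrum in `[ℓ, L]`, `Λ₂` in `[0, ℓ']`,
with a gap `ℓ - ℓ' > 0`, and the step size is small relative to the gap. -/
structure GapAssumptions (Λ₁ : E →L[ℝ] E) (Λ₂ : F →L[ℝ] F) (η L ℓ ℓ' : ℝ) : Prop where
  eta_pos : 0 < η
  nonneg : 0 ≤ ℓ'
  gap : ℓ' < ℓ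
  le_max : ℓ ≤ L
  eta_le : 36 * (η * L ^ 2) ≤ ℓ - ℓ'
  lower : ∀ w, ℓ * ‖w‖ ^ 2 ≤ ⟪Λ₁ w, w⟫_ℝ
  norm_le : ‖Λ₁‖ ≤ L
  adjoint_eq : Λ₁.adjoint = Λ₁
  norm_le' : ‖Λ₂‖ ≤ ℓ'
  lower' : ∀ w, 0 ≤ ⟪Λ₂ w, w⟫_ℝ

omit [CompleteSpace F] in
theorem norm_add_smul_lower {Λ : F →L[ℝ] F} {η ℓ : ℝ} (hη : 0 ≤ η)
    (h : ∀ w, ℓ * ‖w‖ ^ 2 ≤ ⟪Λ w, w⟫_ℝ) (w : F) :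
    (1 + η * ℓ) * ‖w‖ ≤ ‖w + η • Λ w‖ := by
  rcases eq_or_ne w 0 with rfl | hw
  · simp
  have h1 := real_inner_le_norm (w + η • Λ w) w
  rw [inner_add_left, inner_smul_left, real_inner_self_eq_norm_sq, conj_trivial] at h1
  have h2 : η * (ℓ * ‖w‖ ^ 2) ≤ η * ⟪Λ w, w⟫_ℝ := by gcongr; exact h w
  refine le_of_mul_le_mul_right ?_ (norm_pos_iff.2 hw)
  nlinarith

namespace GapAssumptions

variable {Λ₁ : E →L[ℝ] E} {Λ₂ : F →L[ℝ] F} {η L ℓ ℓ' : ℝ} {U : E →L[ℝ] E} {J : E →L[ℝ] F}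

omit [CompleteSpace F] in
theorem max_pos (h : GapAssumptions Λ₁ Λ₂ η L ℓ ℓ') : 0 < L := by
  linarith [h.nonneg, h.gap, h.le_max]

omit [CompleteSpace F] in
theorem eta_max_le (h : GapAssumptions Λ₁ Λ₂ η L ℓ ℓ') : 36 * (η * L) ≤ 1 := by
  refine le_of_mul_le_mul_right ?_ h.max_pos
  linarith [h.eta_le, h.nonneg, h.le_max]

omit [CompleteSpace F] in
theorem eta_gap_le (h : GapAssumptions Λ₁ Λ₂ η L ℓ ℓ') : 36 * (η * (ℓ - ℓ')) ≤ 1 := by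
  have : η * (ℓ - ℓ') ≤ η * L :=
    mul_le_mul_of_nonneg_left (by linarith [h.nonneg, h.le_max]) h.eta_pos.le
  linarith [h.eta_max_le]

/-- The bound `‖X‖² ≤ L` is preserved. -/
theorem norm_sq_step_le (h : GapAssumptions Λ₁ Λ₂ η L ℓ ℓ')
    (hX : ∀ v, ‖U v‖ ^ 2 + ‖J v‖ ^ 2 ≤ L * ‖v‖ ^ 2) (v : E) :
    ‖blockStep Λ₁ η (stackedGram U J) U v‖ ^ 2 + ‖blockStep Λ₂ η (stackedGram U J) J v‖ ^ 2 ≤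
      L * ‖v‖ ^ 2 := by
  have hL := h.max_pos
  have hη := h.eta_pos
  have hb := inner_apply_sub_smul_upper (G := stackedGram U J) hL hη.le
    (by linarith [h.eta_max_le, mul_pos hη hL])
    (stackedGram_symm U J) (fun v => by rw [inner_stackedGram_self]; exact hX v) v
  rw [inner_stackedGram_self] at hb
  have hx := hX v
  have hΛ2 : ‖Λ₂‖ ≤ L := h.norm_le'.trans (h.gap.le.trans h.le_max)
  rw [blockStep_apply, blockStep_apply]
  set G := stackedGram U J
  have h1 : ‖U (v - η • G v) + η • Λ₁ (U v)‖ ≤ ‖U (v - η • G v)‖ + η * L * ‖U v‖ := by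
    refine (norm_add_le _ _).trans ?_
    rw [norm_smul, Real.norm_of_nonneg hη.le, mul_assoc]
    gcongr
    exact Λ₁.le_of_opNorm_le h.norm_le _
  have h2 : ‖J (v - η • G v) + η • Λ₂ (J v)‖ ≤ ‖J (v - η • G v)‖ + η * L * ‖J v‖ := by
    refine (norm_add_le _ _).trans ?_
    rw [norm_smul, Real.norm_of_nonneg hη.le, mul_assoc]
    gcongr
    exact Λ₂.le_of_opNorm_le hΛ2 _
  have h1' := pow_le_pow_left₀ (norm_nonneg _) h1 2
  have h2' := pow_le_pow_left₀ (norm_nonneg _) h2 2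
  set a := ‖U (v - η • G v)‖
  set b := ‖J (v - η • G v)‖
  set c := ‖U v‖
  set e := ‖J v‖
  have hc : 0 ≤ 1 - η * L := by linarith [h.eta_max_le, mul_pos hη hL]
  have hηL : 0 < η * L := mul_pos hη hL
  have hcs : a * c + b * e ≤ L * (1 - η * L) * ‖v‖ ^ 2 := by
    refine (abs_le_of_sq_le_sq' ?_
      (mul_nonneg (mul_nonneg hL.le hc) (sq_nonneg _))).2
    calc (a * c + b * e) ^ 2 ≤ (a ^ 2 + b ^ 2) * (c ^ 2 + e ^ 2) := by
          nlinarith [sq_nonneg (a * e - b * c)]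
      _ ≤ (L * (1 - η * L) ^ 2 * ‖v‖ ^ 2) * (L * ‖v‖ ^ 2) := by gcongr
      _ = _ := by ring
  have h5 : 2 * (η * L) * (a * c + b * e) ≤ 2 * (η * L) * (L * (1 - η * L) * ‖v‖ ^ 2) := by
    gcongr
  have h6 : (η * L) ^ 2 * (c ^ 2 + e ^ 2) ≤ (η * L) ^ 2 * (L * ‖v‖ ^ 2) := by gcongr
  nlinarith

theorem norm_sub_smul_stackedGram_le (h : GapAssumptions Λ₁ Λ₂ η L ℓ ℓ')
    (hX : ∀ v, ‖U v‖ ^ 2 + ‖J v‖ ^ 2 ≤ L * ‖v‖ ^ 2) (v : E) :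
    ‖v - η • stackedGram U J v‖ ≤ ‖v‖ := by
  have := norm_sq_sub_smul_le (G := stackedGram U J) (μ := 0) h.max_pos h.eta_pos.le
    (by linarith [h.eta_max_le, mul_pos h.eta_pos h.max_pos]) le_rfl (stackedGram_symm U J)
    (fun v => by rw [inner_stackedGram_self, zero_mul]; positivity)
    (fun v => by rw [inner_stackedGram_self]; exact hX v) v
  refine (sq_le_sq₀ (norm_nonneg _) (norm_nonneg _)).1 (by simpa using this)

/-- The bottom block grows at most at the rate `ℓ'`. -/
theorem norm_bot_step_le (h : GapAssumptions Λ₁ Λ₂ η L ℓ ℓ')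
    (hX : ∀ v, ‖U v‖ ^ 2 + ‖J v‖ ^ 2 ≤ L * ‖v‖ ^ 2) :
    ‖blockStep Λ₂ η (stackedGram U J) J‖ ≤ (1 + η * ℓ') * ‖J‖ := by
  have hη := h.eta_pos
  have hl := h.nonneg
  refine ContinuousLinearMap.opNorm_le_bound _ (by positivity) fun v => ?_
  rw [blockStep_apply]
  refine (norm_add_le _ _).trans ?_
  rw [norm_smul, Real.norm_of_nonneg hη.le]
  have h1 : ‖J (v - η • stackedGram U J v)‖ ≤ ‖J‖ * ‖v‖ :=
    (J.le_opNorm _).trans (by gcongr; exact h.norm_sub_smul_stackedGram_le hX v)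
  have h2 : ‖Λ₂ (J v)‖ ≤ ℓ' * (‖J‖ * ‖v‖) :=
    (Λ₂.le_of_opNorm_le h.norm_le' _).trans (by gcongr; exact J.le_opNorm _)
  have : η * ‖Λ₂ (J v)‖ ≤ η * (ℓ' * (‖J‖ * ‖v‖)) := by gcongr
  linarith

theorem norm_apply_gram_le (h : GapAssumptions Λ₁ Λ₂ η L ℓ ℓ') {v : E}
    (hU : ‖U (stackedGram U J v)‖ ≤ 2 * L * ‖U v‖) :
    ‖U (stackedGram U J v)‖ ≤ 3 * L * ‖U (v - η • stackedGram U J v)‖ := by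
  have hL := h.max_pos
  have hη := h.eta_pos
  have h1 : ‖U v‖ - η * ‖U (stackedGram U J v)‖ ≤ ‖U (v - η • stackedGram U J v)‖ := by
    rw [map_sub, map_smul]
    refine le_trans ?_ (norm_sub_norm_le _ _)
    rw [norm_smul, Real.norm_of_nonneg hη.le]
  have h2 := h.eta_max_le
  set a := ‖U (stackedGram U J v)‖
  have ha : 0 ≤ a := norm_nonneg _
  have h3 : 36 * (η * L) * a ≤ 1 * a := by gcongr
  have h4 : 3 * L * (‖U v‖ - η * a) ≤ 3 * L * ‖U (v - η • stackedGram U J v)‖ := by gcongr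
  nlinarith

theorem norm_top_step_ge (h : GapAssumptions Λ₁ Λ₂ η L ℓ ℓ') {v : E}
    (hU : ‖U (stackedGram U J v)‖ ≤ 2 * L * ‖U v‖) :
    (1 + η * ℓ - η * (ℓ - ℓ') / 12) * ‖U (v - η • stackedGram U J v)‖ ≤
      ‖blockStep Λ₁ η (stackedGram U J) U v‖ := by
  have hL := h.max_pos
  have hη := h.eta_pos
  rw [blockStep_apply']
  have h1 := h.norm_apply_gram_le hU
  set a := U (v - η • stackedGram U J v)
  set b := U (stackedGram U J v)
  have h2 := norm_add_smul_lower hη.le h.lower a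
  have h3 : ‖η ^ 2 • Λ₁ b‖ ≤ η * (η * L ^ 2) * (3 * ‖a‖) := by
    rw [norm_smul, Real.norm_of_nonneg (by positivity)]
    calc η ^ 2 * ‖Λ₁ b‖ ≤ η ^ 2 * (L * (3 * L * ‖a‖)) := by
          gcongr
          exact (Λ₁.le_of_opNorm_le h.norm_le _).trans (by gcongr)
      _ = _ := by ring
  have h4 : η * (η * L ^ 2) * (3 * ‖a‖) ≤ η * ((ℓ - ℓ') / 36) * (3 * ‖a‖) := by
    gcongr; linarith [h.eta_le]
  have h5 := norm_sub_le_norm_add (a + η • Λ₁ a) (η ^ 2 • Λ₁ b)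
  linarith

theorem bot_error_le (h : GapAssumptions Λ₁ Λ₂ η L ℓ ℓ') {k : ℝ} (hk : 0 ≤ k)
    (hJ : ∀ v, ‖J v‖ ≤ k * ‖U v‖) {v : E}
    (hU : ‖U (stackedGram U J v)‖ ≤ 2 * L * ‖U v‖) :
    ‖η ^ 2 • Λ₂ (J (stackedGram U J v))‖ ≤
      η * (ℓ - ℓ') / 12 * (k * ‖U (v - η • stackedGram U J v)‖) := by
  have hL := h.max_pos
  have hη := h.eta_pos
  have h1 := h.norm_apply_gram_le hU
  rw [norm_smul, Real.norm_of_nonneg (by positivity)]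
  set a := U (v - η • stackedGram U J v)
  calc η ^ 2 * ‖Λ₂ (J (stackedGram U J v))‖ ≤ η ^ 2 * (L * (k * (3 * L * ‖a‖))) := by
        gcongr
        refine (Λ₂.le_of_opNorm_le (h.norm_le'.trans (h.gap.le.trans h.le_max)) _).trans ?_
        gcongr
        exact (hJ _).trans (by gcongr)
    _ = η * (η * L ^ 2) * (3 * (k * ‖a‖)) := by ring
    _ ≤ η * ((ℓ - ℓ') / 36) * (3 * (k * ‖a‖)) := by
        gcongr; linarith [h.eta_le]
    _ = _ := by ring

theorem norm_apply_gram_le_of_ratio (h : GapAssumptions Λ₁ Λ₂ η L ℓ ℓ')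
    (hX : ∀ v, ‖U v‖ ^ 2 + ‖J v‖ ^ 2 ≤ L * ‖v‖ ^ 2) (hJ : ∀ v, ‖J v‖ ≤ ‖U v‖) (v : E) :
    ‖U (stackedGram U J v)‖ ≤ 2 * L * ‖U v‖ := by
  have hL := h.max_pos
  have h1 := norm_sq_apply_le_of_symm_of_bounds (G := stackedGram U J) hL
    (stackedGram_symm U J) (fun v => by rw [inner_stackedGram_self]; positivity)
    (fun v => by rw [inner_stackedGram_self]; exact hX v) v
  rw [inner_stackedGram_self] at h1
  have h2 := hX (stackedGram U J v)
  have h3 := pow_le_pow_left₀ (norm_nonneg _) (hJ v) 2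
  refine (sq_le_sq₀ (norm_nonneg _) (by positivity)).1 ?_
  calc ‖U (stackedGram U J v)‖ ^ 2 ≤ L * ‖stackedGram U J v‖ ^ 2 := by
        linarith [sq_nonneg ‖J (stackedGram U J v)‖]
    _ ≤ L * (L * (‖U v‖ ^ 2 + ‖U v‖ ^ 2)) := by
        gcongr; exact h1.trans (by gcongr)
    _ ≤ (2 * L * ‖U v‖) ^ 2 := by nlinarith [sq_nonneg (L * ‖U v‖)]

/-- The ratio of the two blocks contracts. -/
theorem ratio_step_le (h : GapAssumptions Λ₁ Λ₂ η L ℓ ℓ')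
    (hX : ∀ v, ‖U v‖ ^ 2 + ‖J v‖ ^ 2 ≤ L * ‖v‖ ^ 2) {k : ℝ} (hk : 0 ≤ k) (hk1 : k ≤ 1)
    (hJ : ∀ v, ‖J v‖ ≤ k * ‖U v‖) (v : E) :
    ‖blockStep Λ₂ η (stackedGram U J) J v‖ ≤
      (1 - η * (ℓ - ℓ') / 2) * k * ‖blockStep Λ₁ η (stackedGram U J) U v‖ := by
  have hη := h.eta_pos
  have hl := h.nonneg
  have hU := h.norm_apply_gram_le_of_ratio hX
    (fun v => (hJ v).trans (mul_le_of_le_one_left (norm_nonneg _) hk1)) v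
  have h1 := h.norm_top_step_ge hU
  have h2 := h.bot_error_le hk hJ hU
  have h3 := hJ (v - η • stackedGram U J v)
  rw [blockStep_apply' Λ₂]
  set a := U (v - η • stackedGram U J v)
  set b := J (v - η • stackedGram U J v)
  have h4 : ‖b + η • Λ₂ b‖ ≤ (1 + η * ℓ') * (k * ‖a‖) := by
    refine (norm_add_le _ _).trans ?_
    rw [norm_smul, Real.norm_of_nonneg hη.le]
    have : ‖Λ₂ b‖ ≤ ℓ' * (k * ‖a‖) := (Λ₂.le_of_opNorm_le h.norm_le' _).trans (by gcongr)
    have := mul_le_mul_of_nonneg_left this hη.le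
    linarith
  have h5 := norm_add_le (b + η • Λ₂ b) (η ^ 2 • Λ₂ (J (stackedGram U J v)))
  have hx := h.eta_gap_le
  have hx0 : 0 ≤ η * (ℓ - ℓ') := mul_nonneg hη.le (by linarith [h.gap])
  have hy := h.eta_max_le
  have hy' : η * ℓ ≤ η * L := mul_le_mul_of_nonneg_left h.le_max hη.le
  have hc : 1 + η * ℓ' + η * (ℓ - ℓ') / 12 ≤
      (1 - η * (ℓ - ℓ') / 2) * (1 + η * ℓ - η * (ℓ - ℓ') / 12) := by
    nlinarith
  have hd : 0 ≤ (1 - η * (ℓ - ℓ') / 2) * k := mul_nonneg (by linarith) hk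
  calc _ ≤ (1 + η * ℓ' + η * (ℓ - ℓ') / 12) * (k * ‖a‖) := by linarith
    _ ≤ ((1 - η * (ℓ - ℓ') / 2) * (1 + η * ℓ - η * (ℓ - ℓ') / 12)) * (k * ‖a‖) := by gcongr
    _ = (1 - η * (ℓ - ℓ') / 2) * k * ((1 + η * ℓ - η * (ℓ - ℓ') / 12) * ‖a‖) := by ring
    _ ≤ _ := by gcongr

/-- Once the ratio of the blocks is at most one, `‖X v‖² ≥ (Δ / 4) ‖v‖²` is preserved. -/
theorem norm_sq_step_ge (h : GapAssumptions Λ₁ Λ₂ η L ℓ ℓ')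
    (hX : ∀ v, ‖U v‖ ^ 2 + ‖J v‖ ^ 2 ≤ L * ‖v‖ ^ 2)
    (hJ : ∀ v, ‖J v‖ ≤ ‖U v‖)
    (hm : ∀ v, (ℓ - ℓ') / 4 * ‖v‖ ^ 2 ≤ ‖U v‖ ^ 2 + ‖J v‖ ^ 2) (v : E) :
    (ℓ - ℓ') / 4 * ‖v‖ ^ 2 ≤
      ‖blockStep Λ₁ η (stackedGram U J) U v‖ ^ 2 +
        ‖blockStep Λ₂ η (stackedGram U J) J v‖ ^ 2 := by
  have hη := h.eta_pos
  have hl := h.nonneg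
  have hL := h.max_pos
  have hgap := h.gap
  have hU := h.norm_apply_gram_le_of_ratio hX hJ v
  have h1 := h.norm_top_step_ge hU
  have h2 := h.bot_error_le zero_le_one (fun v => by simpa using hJ v) hU
  have h3 := hJ (v - η • stackedGram U J v)
  have h6 := inner_apply_sub_smul_lower (G := stackedGram U J) (μ := (ℓ - ℓ') / 4) hL hη.le
    (by linarith [h.eta_max_le, mul_pos hη hL]) (by linarith) (by linarith [h.le_max])
    (stackedGram_symm U J)
    (fun v => by rw [inner_stackedGram_self]; exact hm v)
    (fun v => by rw [inner_stackedGram_self]; exact hX v) v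
  rw [inner_stackedGram_self] at h6
  rw [blockStep_apply' Λ₂]
  set a := U (v - η • stackedGram U J v)
  set b := J (v - η • stackedGram U J v)
  set c := η ^ 2 • Λ₂ (J (stackedGram U J v))
  have h4 := norm_add_smul_lower hη.le (ℓ := 0) (fun w => by simpa using h.lower' w) b
  simp only [mul_zero, add_zero, one_mul] at h4 h2
  have h5 := norm_sub_le_norm_add (b + η • Λ₂ b) c
  have hx := h.eta_gap_le
  set x := η * (ℓ - ℓ') with hxdef
  have hx0 : 0 < x := mul_pos hη (by linarith)
  have hxl : x ≤ η * ℓ := mul_le_mul_of_nonneg_left (by linarith) hη.le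
  have ha := norm_nonneg a
  have hb := norm_nonneg b
  have h7 : ‖b‖ ^ 2 - x / 6 * ‖a‖ ^ 2 ≤ ‖b + η • Λ₂ b + c‖ ^ 2 := by
    have h8 : ‖b‖ - x / 12 * ‖a‖ ≤ ‖b + η • Λ₂ b + c‖ := by linarith
    have h10 : x / 12 * ‖a‖ * ‖b‖ ≤ x / 12 * ‖a‖ * ‖a‖ := by gcongr
    rcases le_total 0 (‖b‖ - x / 12 * ‖a‖) with h9 | h9
    · have := pow_le_pow_left₀ h9 h8 2
      nlinarith [sq_nonneg (x / 12 * ‖a‖)]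
    · have : ‖b‖ * ‖b‖ ≤ x / 12 * ‖a‖ * ‖b‖ := by gcongr; linarith
      nlinarith [sq_nonneg ‖b + η • Λ₂ b + c‖]
  have h8 : (1 + 11 / 6 * x) * ‖a‖ ^ 2 ≤ ‖blockStep Λ₁ η (stackedGram U J) U v‖ ^ 2 := by
    have h9 : (1 + 11 / 12 * x) * ‖a‖ ≤ ‖blockStep Λ₁ η (stackedGram U J) U v‖ := by
      refine le_trans ?_ h1
      gcongr; linarith
    have := pow_le_pow_left₀ (by positivity) h9 2
    nlinarith [sq_nonneg (x * ‖a‖)]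
  have h9 := pow_le_pow_left₀ hb h3 2
  have h10 : x * ‖b‖ ^ 2 ≤ x * ‖a‖ ^ 2 := by gcongr
  calc (ℓ - ℓ') / 4 * ‖v‖ ^ 2 ≤
        (1 + 5 / 6 * x) * ((ℓ - ℓ') / 4 * (1 - 2 * η * ((ℓ - ℓ') / 4)) * ‖v‖ ^ 2) := by
        have h11 : 1 ≤ (1 + 5 / 6 * x) * (1 - x / 2) := by nlinarith
        calc _ = (ℓ - ℓ') / 4 * ‖v‖ ^ 2 * 1 := by ring
          _ ≤ (ℓ - ℓ') / 4 * ‖v‖ ^ 2 * ((1 + 5 / 6 * x) * (1 - x / 2)) := by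
            have : 0 ≤ ℓ - ℓ' := by linarith
            gcongr
          _ = _ := by rw [hxdef]; ring
    _ ≤ (1 + 5 / 6 * x) * (‖a‖ ^ 2 + ‖b‖ ^ 2) := by gcongr
    _ ≤ _ := by nlinarith

/-- While the bottom block is small, the top block grows at least at the rate `ℓ - Δ / 2`. -/
theorem norm_top_step_ge_of_small (h : GapAssumptions Λ₁ Λ₂ η L ℓ ℓ')
    (hX : ∀ v, ‖U v‖ ^ 2 + ‖J v‖ ^ 2 ≤ L * ‖v‖ ^ 2) {s : ℝ} (hs : 0 < s)
    (hsΔ : s ^ 2 ≤ (ℓ - ℓ') / 4) (hU : ∀ v, s * ‖v‖ ≤ ‖U v‖)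
    (hJ : ‖J‖ ^ 2 * √L ≤ (ℓ - ℓ') / 8 * s) (v : E) :
    (1 + η * (ℓ - (ℓ - ℓ') / 2)) * s * ‖v‖ ≤ ‖blockStep Λ₁ η (stackedGram U J) U v‖ := by
  have hη := h.eta_pos
  have hl := h.nonneg
  have hL := h.max_pos
  have hgap := h.gap
  have hUL : ∀ v, ‖U v‖ ≤ √L * ‖v‖ := fun v => by
    refine (sq_le_sq₀ (norm_nonneg _) (by positivity)).1 ?_
    rw [mul_pow, Real.sq_sqrt hL.le]
    linarith [hX v, sq_nonneg ‖J v‖]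
  have hsplit : ∀ v, stackedGram U J v = stackedGram U (0 : E →L[ℝ] F) v + J.adjoint (J v) := by
    intro v; simp [stackedGram]
  have hH : ∀ v, ‖U (J.adjoint (J v))‖ ≤ (ℓ - ℓ') / 8 * s * ‖v‖ := fun v => by
    calc ‖U (J.adjoint (J v))‖ ≤ √L * (‖J‖ * (‖J‖ * ‖v‖)) := by
          refine (hUL _).trans ?_
          gcongr
          refine (J.adjoint.le_opNorm _).trans ?_
          rw [LinearIsometryEquiv.norm_map]
          gcongr
          exact J.le_opNorm v
      _ = ‖J‖ ^ 2 * √L * ‖v‖ := by ring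
      _ ≤ _ := by gcongr
  have hAs := stackedGram_symm U (0 : E →L[ℝ] F)
  have hAself : ∀ v, ⟪stackedGram U (0 : E →L[ℝ] F) v, v⟫_ℝ = ‖U v‖ ^ 2 := fun v => by
    rw [inner_stackedGram_self]; simp
  have hAL : ∀ v, ⟪stackedGram U (0 : E →L[ℝ] F) v, v⟫_ℝ ≤ L * ‖v‖ ^ 2 := fun v => by
    rw [hAself]; linarith [hX v, sq_nonneg ‖J v‖]
  have hA0 : ∀ v, s ^ 2 * ‖v‖ ^ 2 ≤ ⟪stackedGram U (0 : E →L[ℝ] F) v, v⟫_ℝ := fun v => by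
    rw [hAself, ← mul_pow]
    exact pow_le_pow_left₀ (by positivity) (hU v) 2
  have hUA : ∀ v, ‖U (stackedGram U (0 : E →L[ℝ] F) v)‖ ≤ L * ‖U v‖ := fun v => by
    refine (sq_le_sq₀ (norm_nonneg _) (by positivity)).1 ?_
    have h1 := norm_sq_apply_le_of_symm_of_bounds hL hAs
      (fun v => by rw [hAself]; positivity) hAL v
    have h2 := hX (stackedGram U (0 : E →L[ℝ] F) v)
    rw [hAself] at h1
    calc _ ≤ L * ‖stackedGram U (0 : E →L[ℝ] F) v‖ ^ 2 := by
          linarith [sq_nonneg ‖J (stackedGram U (0 : E →L[ℝ] F) v)‖]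
      _ ≤ L * (L * ‖U v‖ ^ 2) := by gcongr
      _ = _ := by ring
  have hG : ‖U (stackedGram U J v)‖ ≤ 2 * L * ‖U v‖ := by
    rw [hsplit, map_add]
    refine (norm_add_le _ _).trans ?_
    have h3 : (ℓ - ℓ') / 8 * (s * ‖v‖) ≤ L * ‖U v‖ := by
      gcongr
      · linarith [h.le_max]
      · exact hU v
    linarith [hUA v, hH v]
  refine le_trans ?_ (h.norm_top_step_ge hG)
  have hx := h.eta_gap_le
  set x := η * (ℓ - ℓ') with hxdef
  have hx0 : 0 < x := mul_pos hη (by linarith)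
  have hxl : x ≤ η * ℓ := mul_le_mul_of_nonneg_left (by linarith) hη.le
  have hlL : η * ℓ ≤ η * L := mul_le_mul_of_nonneg_left h.le_max hη.le
  have hlow := inner_apply_sub_smul_lower hL hη.le
    (by linarith [h.eta_max_le, mul_pos hη hL]) (sq_nonneg s) (by linarith [h.le_max]) hAs hA0
    hAL v
  rw [hAself] at hlow
  have h4 : (1 - x / 4 - x ^ 2 / 8) * s * ‖v‖ ≤
      ‖U (v - η • stackedGram U (0 : E →L[ℝ] F) v)‖ := by
    refine abs_le_of_sq_le_sq' (le_trans ?_ hlow) (norm_nonneg _) |>.2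
    rw [mul_pow, mul_pow, mul_comm _ (s ^ 2)]
    gcongr
    have : η * s ^ 2 ≤ x / 4 := by
      have := mul_le_mul_of_nonneg_left hsΔ hη.le
      rw [hxdef]; linarith
    have h5 : (1 - x / 4 - x ^ 2 / 8) ^ 2 ≤ 1 - x / 2 := by
      nlinarith [mul_pos hx0 hx0, mul_pos (mul_pos hx0 hx0) hx0]
    linarith
  have h5 : (1 - x / 4 - x ^ 2 / 8 - x / 8) * s * ‖v‖ ≤ ‖U (v - η • stackedGram U J v)‖ := by
    have h6 : U (v - η • stackedGram U J v) =
        U (v - η • stackedGram U (0 : E →L[ℝ] F) v) - η • U (J.adjoint (J v)) := by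
      rw [hsplit]; simp only [map_sub, map_smul, map_add]; module
    rw [h6]
    refine le_trans ?_ (norm_sub_norm_le _ _)
    rw [norm_smul, Real.norm_of_nonneg hη.le]
    have := mul_le_mul_of_nonneg_left (hH v) hη.le
    have h7 : η * ((ℓ - ℓ') / 8 * s * ‖v‖) = x / 8 * s * ‖v‖ := by rw [hxdef]; ring
    linarith
  have hy := h.eta_max_le
  have hc : 1 + η * (ℓ - (ℓ - ℓ') / 2) ≤
      (1 + η * ℓ - x / 12) * (1 - x / 4 - x ^ 2 / 8 - x / 8) := by
    have : η * (ℓ - (ℓ - ℓ') / 2) = η * ℓ - x / 2 := by rw [hxdef]; ring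
    rw [this]
    have h8 : η * ℓ * x ≤ 1 / 36 * x := by gcongr; linarith
    have h9 : x ^ 2 ≤ 1 / 36 * x := by nlinarith
    have h10 : η * ℓ * x ^ 2 ≤ 1 / 36 * x ^ 2 := by gcongr; linarith
    nlinarith [mul_pos (mul_pos hx0 hx0) hx0]
  calc _ ≤ (1 + η * ℓ - x / 12) * (1 - x / 4 - x ^ 2 / 8 - x / 8) * (s * ‖v‖) := by
        rw [mul_assoc]; gcongr
    _ = (1 + η * ℓ - x / 12) * ((1 - x / 4 - x ^ 2 / 8 - x / 8) * s * ‖v‖) := by ring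
    _ ≤ _ := by
        gcongr
        linarith

end GapAssumptions

theorem error_step_eq {A : Type*} [Ring A] [StarRing A] [Algebra ℝ A] [StarModule ℝ A]
    (η : ℝ) {U Λ H : A} (hΛ : star Λ = Λ) (hH : star H = H) :
    (U + η • (Λ * U - U * (star U * U + H))) * star (U + η • (Λ * U - U * (star U * U + H))) - Λ =
      (1 - η • (U * star U)) * (U * star U - Λ) * (1 - η • (U * star U))
      - η ^ 2 • (U * star U * (U * star U - Λ) * (U * star U))
      + η ^ 2 • ((U * star U - Λ) * (U * star U) * (U * star U - Λ))
      - η • ((1 - η • (U * star U - Λ)) * (U * H * star U)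
        + U * H * star U * (1 - η • (U * star U - Λ)))
      + η ^ 2 • (U * H * H * star U) := by
  simp only [star_add, star_sub, star_mul, star_smul, hΛ, hH, star_star, star_trivial]
  simp only [mul_add, add_mul, mul_sub, sub_mul, smul_mul_assoc, mul_smul_comm, smul_add,
    smul_sub, smul_smul, one_mul, mul_one, ← mul_assoc]
  module

theorem opNorm_star (U : E →L[ℝ] E) : ‖star U‖ = ‖U‖ :=
  LinearIsometryEquiv.norm_map ContinuousLinearMap.adjoint U

theorem opNorm_mul_star_le (U : E →L[ℝ] E) : ‖U * star U‖ ≤ ‖U‖ ^ 2 := by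
  refine (norm_mul_le _ _).trans_eq ?_
  rw [opNorm_star, sq]

theorem norm_sq_adjoint_ge [FiniteDimensional ℝ E] {U : E →L[ℝ] E} {c : ℝ} (hc : 0 < c)
    (hU : ∀ v, c * ‖v‖ ^ 2 ≤ ‖U v‖ ^ 2) (w : E) : c * ‖w‖ ^ 2 ≤ ‖U.adjoint w‖ ^ 2 := by
  have hinj : Function.Injective (U : E →ₗ[ℝ] E) := by
    refine (injective_iff_map_eq_zero _).2 fun v hv => ?_
    have hv' : U v = 0 := hv
    have h1 := hU v
    rw [hv'] at h1
    by_contra hne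
    have : 0 < c * ‖v‖ ^ 2 := by positivity
    simp at h1
    linarith
  obtain ⟨v, hv⟩ := LinearMap.injective_iff_surjective.1 hinj w
  have hv' : U v = w := hv
  rcases eq_or_ne w 0 with rfl | hw
  · simp
  have hn : 0 < ‖w‖ ^ 2 := by positivity
  have h1 : ‖w‖ ^ 2 ≤ ‖v‖ * ‖U.adjoint w‖ := by
    rw [← real_inner_self_eq_norm_sq]
    nth_rw 1 [← hv']
    rw [← ContinuousLinearMap.adjoint_inner_right]
    exact real_inner_le_norm _ _
  have h2 := pow_le_pow_left₀ hn.le h1 2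
  have h3 := hU v
  rw [hv'] at h3
  refine le_of_mul_le_mul_right ?_ hn
  calc c * ‖w‖ ^ 2 * ‖w‖ ^ 2 = c * (‖w‖ ^ 2) ^ 2 := by ring
    _ ≤ c * (‖v‖ * ‖U.adjoint w‖) ^ 2 := by gcongr
    _ = (c * ‖v‖ ^ 2) * ‖U.adjoint w‖ ^ 2 := by ring
    _ ≤ ‖w‖ ^ 2 * ‖U.adjoint w‖ ^ 2 := by gcongr
    _ = _ := by ring

omit [CompleteSpace E] [CompleteSpace F] in
theorem opNorm_sq_le_of_sq_le {Y : E →L[ℝ] F} {c : ℝ} (hc : 0 ≤ c)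
    (hY : ∀ v, ‖Y v‖ ^ 2 ≤ c * ‖v‖ ^ 2) : ‖Y‖ ^ 2 ≤ c := by
  rw [← Real.sq_sqrt hc]
  refine pow_le_pow_left₀ (norm_nonneg _) (Y.opNorm_le_bound (by positivity) fun v => ?_) 2
  refine (sq_le_sq₀ (norm_nonneg _) (by positivity)).1 ?_
  rw [mul_pow, Real.sq_sqrt hc]
  exact hY v

namespace GapAssumptions

variable {Λ₁ : E →L[ℝ] E} {Λ₂ : F →L[ℝ] F} {η L ℓ ℓ' : ℝ} {U : E →L[ℝ] E} {J : E →L[ℝ] F}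

omit [CompleteSpace F] in
theorem norm_mul_star_sub_le (h : GapAssumptions Λ₁ Λ₂ η L ℓ ℓ')
    (hX : ∀ v, ‖U v‖ ^ 2 + ‖J v‖ ^ 2 ≤ L * ‖v‖ ^ 2) : ‖U * star U - Λ₁‖ ≤ 2 * L := by
  have hU : ‖U‖ ^ 2 ≤ L := opNorm_sq_le_of_sq_le h.max_pos.le
    fun v => by linarith [hX v, sq_nonneg ‖J v‖]
  refine (norm_sub_le _ _).trans ?_
  linarith [h.norm_le, opNorm_mul_star_le U]

/-- Perturbed linear convergence of `U Uᵀ` towards `Λ₁`. -/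
theorem error_step_le [FiniteDimensional ℝ E] (h : GapAssumptions Λ₁ Λ₂ η L ℓ ℓ')
    (hX : ∀ v, ‖U v‖ ^ 2 + ‖J v‖ ^ 2 ≤ L * ‖v‖ ^ 2)
    (hU : ∀ v, (ℓ - ℓ') / 8 * ‖v‖ ^ 2 ≤ ‖U v‖ ^ 2) :
    ‖blockStep Λ₁ η (stackedGram U J) U * star (blockStep Λ₁ η (stackedGram U J) U) - Λ₁‖ ≤
      (1 - η * (ℓ - ℓ') / 8) * ‖U * star U - Λ₁‖ + 3 * (η * L) * ‖J‖ ^ 2 := by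
  have hη := h.eta_pos
  have hL := h.max_pos
  have hgap := h.gap
  have hUL : ‖U‖ ^ 2 ≤ L := opNorm_sq_le_of_sq_le hL.le
    fun v => by linarith [hX v, sq_nonneg ‖J v‖]
  have hJL : ‖J‖ ^ 2 ≤ L := opNorm_sq_le_of_sq_le hL.le
    fun v => by linarith [hX v, sq_nonneg ‖U v‖]
  have he := h.norm_mul_star_sub_le hX
  have hstep : blockStep Λ₁ η (stackedGram U J) U =
      U + η • (Λ₁ * U - U * (star U * U + J.adjoint ∘L J)) := rfl
  have hH : star (J.adjoint ∘L J) = J.adjoint ∘L J := by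
    rw [ContinuousLinearMap.star_eq_adjoint, ContinuousLinearMap.adjoint_comp,
      ContinuousLinearMap.adjoint_adjoint]
  have hHn : ‖J.adjoint ∘L J‖ ≤ ‖J‖ ^ 2 := by
    refine (ContinuousLinearMap.opNorm_comp_le _ _).trans ?_
    rw [LinearIsometryEquiv.norm_map, sq]
  rw [hstep, error_step_eq η (by rw [ContinuousLinearMap.star_eq_adjoint, h.adjoint_eq]) hH]
  set H := J.adjoint ∘L J
  set P := U * star U with hP
  set e := P - Λ₁
  set x := η * (ℓ - ℓ') with hxdef
  have hx : 0 < x := mul_pos hη (by linarith)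
  have hPn : ‖P‖ ≤ L := (opNorm_mul_star_le U).trans hUL
  have hPs : ∀ x y, ⟪P x, y⟫_ℝ = ⟪x, P y⟫_ℝ := fun x y => by
    simp [hP, ContinuousLinearMap.star_eq_adjoint,
      ← ContinuousLinearMap.adjoint_inner_right]
  have hPself : ∀ v, ⟪P v, v⟫_ℝ = ‖U.adjoint v‖ ^ 2 := fun v => by
    rw [← real_inner_self_eq_norm_sq, ContinuousLinearMap.adjoint_inner_left, real_inner_comm]
    rfl
  have h1P : ‖1 - η • P‖ ^ 2 ≤ 1 - 71 / 36 * (x / 8) := by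
    have hx1 := h.eta_gap_le
    refine opNorm_sq_le_of_sq_le (by linarith) fun v => ?_
    have := norm_sq_sub_smul_le (G := P) (μ := (ℓ - ℓ') / 8) hL hη.le
      (by linarith [h.eta_max_le, mul_pos hη hL]) (by linarith) hPs
      (fun v => by
        rw [hPself]
        exact norm_sq_adjoint_ge (by linarith) hU v)
      (fun v => by
        refine (real_inner_le_norm _ _).trans ?_
        rw [sq, ← mul_assoc]
        gcongr
        exact P.le_of_opNorm_le hPn v) v
    refine this.trans (mul_le_mul_of_nonneg_right ?_ (sq_nonneg _))
    have h2 : 0 ≤ (1 / 36 - η * L) * (x / 8) := mul_nonneg (by linarith [h.eta_max_le]) (by linarith)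
    have h3 : (2 - η * L) * (η * ((ℓ - ℓ') / 8)) = (2 - η * L) * (x / 8) := by
      rw [hxdef]; ring
    linarith
  have hQn : ‖U * H * star U‖ ≤ L * ‖J‖ ^ 2 := by
    calc ‖U * H * star U‖ ≤ ‖U‖ * ‖H‖ * ‖U‖ := by
          refine (norm_mul_le _ _).trans ?_
          rw [opNorm_star]
          gcongr
          exact norm_mul_le _ _
      _ = ‖U‖ ^ 2 * ‖H‖ := by ring
      _ ≤ _ := by gcongr
  have hQn' : ‖U * H * H * star U‖ ≤ L * (‖J‖ ^ 2 * L) := by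
    calc ‖U * H * H * star U‖ ≤ ‖U‖ * ‖H‖ * ‖H‖ * ‖U‖ := by
          refine (norm_mul_le _ _).trans ?_
          rw [opNorm_star]
          gcongr
          exact (norm_mul_le _ _).trans (by gcongr; exact norm_mul_le _ _)
      _ = ‖U‖ ^ 2 * (‖H‖ * ‖H‖) := by ring
      _ ≤ _ := by gcongr; exact hHn.trans hJL
  have h1e : ‖1 - η • e‖ ≤ 1 + η * (2 * L) := by
    refine (norm_sub_le _ _).trans ?_
    rw [norm_smul, Real.norm_of_nonneg hη.le]
    gcongr
    exact ContinuousLinearMap.norm_id_le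
  have t1 : ‖(1 - η • P) * e * (1 - η • P)‖ ≤ (1 - 71 / 36 * (x / 8)) * ‖e‖ := by
    calc _ ≤ ‖1 - η • P‖ * ‖e‖ * ‖1 - η • P‖ :=
          (norm_mul_le _ _).trans (by gcongr; exact norm_mul_le _ _)
      _ = ‖1 - η • P‖ ^ 2 * ‖e‖ := by ring
      _ ≤ _ := by gcongr
  have t2 : ‖η ^ 2 • (P * e * P)‖ ≤ η ^ 2 * (L * ‖e‖ * L) := by
    rw [norm_smul, Real.norm_of_nonneg (sq_nonneg η)]
    gcongr
    exact (norm_mul_le _ _).trans (by gcongr; exact (norm_mul_le _ _).trans (by gcongr))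
  have t3 : ‖η ^ 2 • (e * P * e)‖ ≤ η ^ 2 * (2 * L * L * ‖e‖) := by
    rw [norm_smul, Real.norm_of_nonneg (sq_nonneg η)]
    gcongr
    exact (norm_mul_le _ _).trans (by gcongr; exact (norm_mul_le _ _).trans (by gcongr))
  have t4 : ‖η • ((1 - η • e) * (U * H * star U) + U * H * star U * (1 - η • e))‖ ≤
      η * ((1 + η * (2 * L)) * (L * ‖J‖ ^ 2) + L * ‖J‖ ^ 2 * (1 + η * (2 * L))) := by
    rw [norm_smul, Real.norm_of_nonneg hη.le]
    gcongr
    refine (norm_add_le _ _).trans ?_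
    gcongr <;> exact (norm_mul_le _ _).trans (by gcongr)
  have t5 : ‖η ^ 2 • (U * H * H * star U)‖ ≤ η ^ 2 * (L * (‖J‖ ^ 2 * L)) := by
    rw [norm_smul, Real.norm_of_nonneg (sq_nonneg η)]
    gcongr
  have t6 : 3 * (η * (η * L ^ 2)) * ‖e‖ ≤ x / 12 * ‖e‖ := by
    gcongr
    have := mul_le_mul_of_nonneg_left h.eta_le hη.le
    rw [hxdef]; linarith
  have t7 : 5 * (η * L) * (η * L * ‖J‖ ^ 2) ≤ 1 * (η * L * ‖J‖ ^ 2) := by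
    gcongr
    linarith [h.eta_max_le, mul_pos hη hL]
  have t8 : 0 ≤ x * ‖e‖ := by positivity
  refine (norm_add_le _ _).trans ?_
  refine (add_le_add_left (norm_sub_le _ _) _).trans ?_
  refine (add_le_add_left (add_le_add_left (norm_add_le _ _) _) _).trans ?_
  refine (add_le_add_left (add_le_add_left (add_le_add_left (norm_sub_le _ _) _) _) _).trans ?_
  linarith

end GapAssumptions

/-- The two blocks of a gradient descent trajectory. -/
structure IsBlockDescent (Λ₁ : E →L[ℝ] E) (Λ₂ : F →L[ℝ] F) (η : ℝ) (U : ℕ → E →L[ℝ] E)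
    (J : ℕ → E →L[ℝ] F) : Prop where
  top : ∀ t, U (t + 1) = blockStep Λ₁ η (stackedGram (U t) (J t)) (U t)
  bot : ∀ t, J (t + 1) = blockStep Λ₂ η (stackedGram (U t) (J t)) (J t)

namespace GapAssumptions

variable {Λ₁ : E →L[ℝ] E} {Λ₂ : F →L[ℝ] F} {η L ℓ ℓ' : ℝ} {U : ℕ → E →L[ℝ] E}
  {J : ℕ → E →L[ℝ] F}

theorem norm_sq_le (h : GapAssumptions Λ₁ Λ₂ η L ℓ ℓ') (hd : IsBlockDescent Λ₁ Λ₂ η U J)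
    (hX : ∀ v, ‖U 0 v‖ ^ 2 + ‖J 0 v‖ ^ 2 ≤ L * ‖v‖ ^ 2) (t : ℕ) :
    ∀ v, ‖U t v‖ ^ 2 + ‖J t v‖ ^ 2 ≤ L * ‖v‖ ^ 2 := by
  induction t with
  | zero => exact hX
  | succ t ih =>
    rw [hd.top, hd.bot]
    exact h.norm_sq_step_le ih

/-- Growth phase: `U` and `J` evolve at controlled exponential rates as long as the lower bound
for `U` has not reached `√Δ / 2`. -/
theorem growth_phase (h : GapAssumptions Λ₁ Λ₂ η L ℓ ℓ') (hd : IsBlockDescent Λ₁ Λ₂ η U J)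
    (hX : ∀ v, ‖U 0 v‖ ^ 2 + ‖J 0 v‖ ^ 2 ≤ L * ‖v‖ ^ 2) {s j : ℝ} (hs : 0 < s)
    (hU : ∀ v, s * ‖v‖ ≤ ‖U 0 v‖) (hJ : ‖J 0‖ ≤ j)
    (hsj : ∀ t : ℕ, ((1 + η * (ℓ - (ℓ - ℓ') / 2)) ^ t * s) ^ 2 ≤ (ℓ - ℓ') / 4 →
      ((1 + η * ℓ') ^ t * j) ^ 2 * √L ≤ (ℓ - ℓ') / 8 * ((1 + η * (ℓ - (ℓ - ℓ') / 2)) ^ t * s))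
    (n : ℕ) (hn : ∀ t < n, ((1 + η * (ℓ - (ℓ - ℓ') / 2)) ^ t * s) ^ 2 ≤ (ℓ - ℓ') / 4) :
    (∀ v, (1 + η * (ℓ - (ℓ - ℓ') / 2)) ^ n * s * ‖v‖ ≤ ‖U n v‖) ∧
      ‖J n‖ ≤ (1 + η * ℓ') ^ n * j := by
  have hη := h.eta_pos
  have hl := h.nonneg
  have hb : 0 ≤ ℓ - (ℓ - ℓ') / 2 := by linarith [h.gap]
  induction n with
  | zero => simpa using ⟨hU, hJ⟩
  | succ n ih =>
    obtain ⟨ih1, ih2⟩ := ih fun t ht => hn t (ht.trans n.lt_succ_self)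
    have hXn := h.norm_sq_le hd hX n
    have hsn := hn n n.lt_succ_self
    rw [hd.top, hd.bot]
    constructor
    · have := h.norm_top_step_ge_of_small hXn (s := (1 + η * (ℓ - (ℓ - ℓ') / 2)) ^ n * s)
        (by positivity) hsn ih1 (le_trans (by gcongr) (hsj n hsn))
      rw [pow_succ']
      simpa only [mul_assoc] using this
    · refine (h.norm_bot_step_le hXn).trans ?_
      rw [pow_succ', mul_assoc]
      gcongr

/-- The growth phase ends after `O(log (Δ / s²) / (η Δ))` steps. -/
theorem exists_end_of_growth (h : GapAssumptions Λ₁ Λ₂ η L ℓ ℓ')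
    (hd : IsBlockDescent Λ₁ Λ₂ η U J)
    (hX : ∀ v, ‖U 0 v‖ ^ 2 + ‖J 0 v‖ ^ 2 ≤ L * ‖v‖ ^ 2) {s j : ℝ} (hs : 0 < s)
    (hsΔ : s ^ 2 < (ℓ - ℓ') / 4)
    (hU : ∀ v, s * ‖v‖ ≤ ‖U 0 v‖) (hJ : ‖J 0‖ ≤ j)
    (hsj : ∀ t : ℕ, ((1 + η * (ℓ - (ℓ - ℓ') / 2)) ^ t * s) ^ 2 ≤ (ℓ - ℓ') / 4 →
      ((1 + η * ℓ') ^ t * j) ^ 2 * √L ≤ (ℓ - ℓ') / 8 * ((1 + η * (ℓ - (ℓ - ℓ') / 2)) ^ t * s)) :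
    ∃ N : ℕ, (N : ℝ) ≤ 1 + 2 * (1 / (η * (ℓ - ℓ')) * Real.log ((ℓ - ℓ') / (4 * s ^ 2))) ∧
      (∀ v, ‖J N v‖ ≤ ‖U N v‖) ∧ ∀ v, (ℓ - ℓ') / 4 * ‖v‖ ^ 2 ≤ ‖U N v‖ ^ 2 := by
  have hη := h.eta_pos
  have hl := h.nonneg
  have hL := h.max_pos
  have hgap := h.gap
  set b := 1 + η * (ℓ - (ℓ - ℓ') / 2) with hbdef
  set x := η * (ℓ - ℓ') with hxdef
  have hx : 0 < x := mul_pos hη (by linarith)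
  have hbx : 1 + x / 2 ≤ b := by
    have := mul_nonneg hη.le hl
    rw [hbdef, hxdef]; nlinarith
  have hb1 : 1 < b := by linarith
  have hj : 0 ≤ j := (norm_nonneg _).trans hJ
  have hex : ∃ n : ℕ, (ℓ - ℓ') / 4 < (b ^ n * s) ^ 2 := by
    obtain ⟨n, hn⟩ := pow_unbounded_of_one_lt ((ℓ - ℓ') / 4 / s ^ 2) hb1
    refine ⟨n, ?_⟩
    rw [div_lt_iff₀ (by positivity)] at hn
    refine hn.trans_le ?_
    rw [mul_pow]
    gcongr
    exact le_self_pow₀ (one_le_pow₀ hb1.le) two_ne_zero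
  classical
  obtain ⟨N, hN, hmin⟩ : ∃ N : ℕ, (ℓ - ℓ') / 4 < (b ^ N * s) ^ 2 ∧
      ∀ m < N, (b ^ m * s) ^ 2 ≤ (ℓ - ℓ') / 4 :=
    ⟨Nat.find hex, Nat.find_spec hex, fun m hm => not_lt.1 (Nat.find_min hex hm)⟩
  obtain ⟨g1, g2⟩ := h.growth_phase hd hX hs hU hJ hsj N hmin
  obtain ⟨M, rfl⟩ : ∃ M, N = M + 1 := by
    refine Nat.exists_eq_succ_of_ne_zero ?_
    rintro rfl
    simp at hN
    linarith
  have hM := hmin M M.lt_succ_self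
  have hUN : ∀ v, (ℓ - ℓ') / 4 * ‖v‖ ^ 2 ≤ ‖U (M + 1) v‖ ^ 2 := fun v => by
    have := pow_le_pow_left₀ (by positivity) (g1 v) 2
    rw [mul_pow] at this
    exact le_trans (by gcongr) this
  refine ⟨M + 1, ?_, fun v => ?_, hUN⟩
  · have h1 : b ^ M * b ^ M ≤ (ℓ - ℓ') / (4 * s ^ 2) := by
      rw [le_div_iff₀ (by positivity)]
      nlinarith
    have h2 := Real.log_le_log (by positivity) h1
    rw [← pow_add, Real.log_pow] at h2
    have h3 : x / 4 ≤ Real.log b := by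
      refine le_trans ?_ (Real.log_le_log (by linarith) hbx)
      have h4 := Real.one_sub_inv_le_log_of_pos (show 0 < 1 + x / 2 by linarith)
      refine le_trans ?_ h4
      have h5 := h.eta_gap_le
      rw [le_sub_iff_add_le, ← le_sub_iff_add_le', inv_le_comm₀ (by linarith) (by linarith),
        inv_le_iff_one_le_mul₀ (by linarith)]
      nlinarith
    have h6 : (M : ℝ) * x ≤ 2 * Real.log ((ℓ - ℓ') / (4 * s ^ 2)) := by
      have : ((M + M : ℕ) : ℝ) * (x / 4) ≤ ((M + M : ℕ) : ℝ) * Real.log b := by gcongr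
      push_cast at this h2
      linarith
    have h7 : (M : ℝ) ≤ 2 * Real.log ((ℓ - ℓ') / (4 * s ^ 2)) / x := by
      rwa [le_div_iff₀ hx]
    push_cast
    calc (M : ℝ) + 1 ≤ 1 + 2 * Real.log ((ℓ - ℓ') / (4 * s ^ 2)) / x := by linarith
      _ = _ := by ring
  · have h1 := hsj M hM
    have h2 : b ^ M * s ≤ √L / 2 := by
      refine (abs_le_of_sq_le_sq' ?_ (by positivity)).2
      rw [div_pow, Real.sq_sqrt hL.le]
      linarith [h.le_max]
    have h3 : ((1 + η * ℓ') ^ M * j) ^ 2 ≤ (ℓ - ℓ') / 16 := by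
      refine le_of_mul_le_mul_right ?_ (Real.sqrt_pos.2 hL)
      have : (ℓ - ℓ') / 8 * (b ^ M * s) ≤ (ℓ - ℓ') / 8 * (√L / 2) := by gcongr
      linarith
    have h4 : 1 + η * ℓ' ≤ 37 / 36 := by
      have : η * ℓ' ≤ η * L := by gcongr; linarith [h.le_max]
      linarith [h.eta_max_le]
    have h5 : ‖J (M + 1)‖ ^ 2 ≤ (ℓ - ℓ') / 4 := by
      calc ‖J (M + 1)‖ ^ 2 ≤ ((1 + η * ℓ') ^ (M + 1) * j) ^ 2 := by gcongr
        _ = (1 + η * ℓ') ^ 2 * ((1 + η * ℓ') ^ M * j) ^ 2 := by ring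
        _ ≤ (37 / 36) ^ 2 * ((ℓ - ℓ') / 16) := by gcongr
        _ ≤ _ := by linarith
    refine (sq_le_sq₀ (norm_nonneg _) (norm_nonneg _)).1 (le_trans ?_ (hUN v))
    calc ‖J (M + 1) v‖ ^ 2 ≤ (‖J (M + 1)‖ * ‖v‖) ^ 2 := by
          gcongr; exact ContinuousLinearMap.le_opNorm _ _
      _ ≤ _ := by rw [mul_pow]; gcongr

/-- Invariants of the local phase. -/
theorem local_phase (h : GapAssumptions Λ₁ Λ₂ η L ℓ ℓ') (hd : IsBlockDescent Λ₁ Λ₂ η U J)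
    (hX : ∀ v, ‖U 0 v‖ ^ 2 + ‖J 0 v‖ ^ 2 ≤ L * ‖v‖ ^ 2) {N : ℕ}
    (hJ : ∀ v, ‖J N v‖ ≤ ‖U N v‖) (hU : ∀ v, (ℓ - ℓ') / 4 * ‖v‖ ^ 2 ≤ ‖U N v‖ ^ 2) (n : ℕ) :
    (∀ v, ‖J (N + n) v‖ ≤ (1 - η * (ℓ - ℓ') / 2) ^ n * ‖U (N + n) v‖) ∧
      ∀ v, (ℓ - ℓ') / 4 * ‖v‖ ^ 2 ≤ ‖U (N + n) v‖ ^ 2 + ‖J (N + n) v‖ ^ 2 := by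
  have hx := h.eta_gap_le
  have hx0 : 0 < η * (ℓ - ℓ') := mul_pos h.eta_pos (by linarith [h.gap])
  induction n with
  | zero => exact ⟨by simpa using hJ, fun v => (hU v).trans (by simp)⟩
  | succ n ih =>
    have hXn := h.norm_sq_le hd hX (N + n)
    have hk : (1 - η * (ℓ - ℓ') / 2) ^ n ≤ 1 := pow_le_one₀ (by linarith) (by linarith)
    rw [← add_assoc, hd.top, hd.bot]
    refine ⟨fun v => ?_, fun v => ?_⟩
    · rw [pow_succ']
      exact h.ratio_step_le hXn (pow_nonneg (by linarith) _) hk ih.1 v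
    · exact h.norm_sq_step_ge hXn
        (fun v => (ih.1 v).trans (mul_le_of_le_one_left (norm_nonneg _) hk)) ih.2 v

/-- Linear convergence in the local phase. -/
theorem local_convergence [FiniteDimensional ℝ E] (h : GapAssumptions Λ₁ Λ₂ η L ℓ ℓ')
    (hd : IsBlockDescent Λ₁ Λ₂ η U J)
    (hX : ∀ v, ‖U 0 v‖ ^ 2 + ‖J 0 v‖ ^ 2 ≤ L * ‖v‖ ^ 2) {N : ℕ}
    (hJ : ∀ v, ‖J N v‖ ≤ ‖U N v‖) (hU : ∀ v, (ℓ - ℓ') / 4 * ‖v‖ ^ 2 ≤ ‖U N v‖ ^ 2) (n : ℕ) :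
    ‖U (N + n) * star (U (N + n)) - Λ₁‖ ≤
        (1 - η * (ℓ - ℓ') / 8) ^ n * (10 * L ^ 2 / (ℓ - ℓ')) ∧
      ‖J (N + n)‖ ≤ (1 - η * (ℓ - ℓ') / 8) ^ n * √L := by
  have hη := h.eta_pos
  have hL := h.max_pos
  have hΔ : 0 < ℓ - ℓ' := by linarith [h.gap]
  set x := η * (ℓ - ℓ') with hxdef
  have hx1 : 36 * x ≤ 1 := h.eta_gap_le
  have hx0 : 0 < x := mul_pos hη hΔ
  have hJn : ∀ n, ‖J (N + n)‖ ≤ (1 - x / 2) ^ n * √L := fun n => by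
    have hk : 0 ≤ (1 - x / 2) ^ n := pow_nonneg (by linarith) _
    refine ContinuousLinearMap.opNorm_le_bound _ (by positivity) fun v => ?_
    refine ((h.local_phase hd hX hJ hU n).1 v).trans ?_
    rw [mul_assoc]
    gcongr
    refine (sq_le_sq₀ (norm_nonneg _) (by positivity)).1 ?_
    rw [mul_pow, Real.sq_sqrt hL.le]
    linarith [h.norm_sq_le hd hX (N + n) v, sq_nonneg ‖J (N + n) v‖]
  have hUn : ∀ n v, (ℓ - ℓ') / 8 * ‖v‖ ^ 2 ≤ ‖U (N + n) v‖ ^ 2 := fun n v => by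
    obtain ⟨h1, h2⟩ := h.local_phase hd hX hJ hU n
    have hk : (1 - x / 2) ^ n ≤ 1 := pow_le_one₀ (by linarith) (by linarith)
    have h3 := pow_le_pow_left₀ (norm_nonneg _)
      ((h1 v).trans (mul_le_of_le_one_left (norm_nonneg _) hk)) 2
    linarith [h2 v]
  refine ⟨?_, (hJn n).trans ?_⟩
  · have key : ‖U (N + n) * star (U (N + n)) - Λ₁‖ + 8 * L ^ 2 / (ℓ - ℓ') * (1 - x / 2) ^ n ≤
        (1 - x / 8) ^ n * (10 * L ^ 2 / (ℓ - ℓ')) := by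
      induction n with
      | zero =>
        have h1 := h.norm_mul_star_sub_le (h.norm_sq_le hd hX (N + 0))
        have h2 : 2 * L ≤ 2 * L ^ 2 / (ℓ - ℓ') := by
          rw [le_div_iff₀ hΔ]
          nlinarith [h.le_max, h.nonneg]
        have h3 : 10 * L ^ 2 / (ℓ - ℓ') = 2 * L ^ 2 / (ℓ - ℓ') + 8 * L ^ 2 / (ℓ - ℓ') := by ring
        rw [pow_zero, pow_zero, one_mul, mul_one, h3]
        linarith
      | succ n ih =>
        have h1 := h.error_step_le (h.norm_sq_le hd hX (N + n)) (hUn n)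
        rw [← hd.top, add_assoc, ← hxdef] at h1
        have hk0 : 0 ≤ (1 - x / 2) ^ n := pow_nonneg (by linarith) _
        have hk1 : (1 - x / 2) ^ n ≤ 1 := pow_le_one₀ (by linarith) (by linarith)
        have h2 : ‖J (N + n)‖ ^ 2 ≤ (1 - x / 2) ^ n * L := by
          refine (pow_le_pow_left₀ (norm_nonneg _) (hJn n) 2).trans ?_
          rw [mul_pow, Real.sq_sqrt hL.le]
          gcongr
          exact pow_le_of_le_one hk0 hk1 two_ne_zero
        have h3 : 3 * (η * L) * ‖J (N + n)‖ ^ 2 ≤ 3 * (η * L) * ((1 - x / 2) ^ n * L) := by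
          gcongr
        have h4 : 3 * (η * L) * ((1 - x / 2) ^ n * L) =
            8 * L ^ 2 / (ℓ - ℓ') * (3 / 8 * x) * (1 - x / 2) ^ n := by
          rw [hxdef]; field_simp
        have h5 := mul_le_mul_of_nonneg_left ih (show 0 ≤ 1 - x / 8 by linarith)
        rw [pow_succ' (1 - x / 2), pow_succ' (1 - x / 8)]
        linarith
    refine le_trans ?_ key
    have : 0 ≤ 8 * L ^ 2 / (ℓ - ℓ') * (1 - x / 2) ^ n :=
      mul_nonneg (by positivity) (pow_nonneg (by linarith) _)
    linarith
  · gcongr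
    · linarith
    · linarith

end GapAssumptions

end Operators

section Scalars

/-- The condition on the initial size of `J` is exactly what keeps `J` negligible compared to `U`
during the whole growth phase. -/
theorem growth_ratio_bound {η L ℓ ℓ' κ c s j : ℝ} (hη : 0 < η) (hL : 0 < L) (hℓ' : 0 ≤ ℓ')
    (hgap : ℓ' < ℓ) (hs : 0 < s)
    (hκ : κ = Real.log (1 + η * ℓ') / Real.log (1 + η * (ℓ - (ℓ - ℓ') / 2)))
    (hc : c = (ℓ - ℓ') ^ ((1 : ℝ) - κ / 2) / (2 ^ ((3 : ℝ) - κ) * √L))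
    (hj : j ^ 2 ≤ c * s ^ ((1 : ℝ) + κ)) (t : ℕ)
    (ht : ((1 + η * (ℓ - (ℓ - ℓ') / 2)) ^ t * s) ^ 2 ≤ (ℓ - ℓ') / 4) :
    ((1 + η * ℓ') ^ t * j) ^ 2 * √L ≤
      (ℓ - ℓ') / 8 * ((1 + η * (ℓ - (ℓ - ℓ') / 2)) ^ t * s) := by
  have hηℓ : 0 ≤ η * ℓ' := by positivity
  have hab : 1 + η * ℓ' ≤ 1 + η * (ℓ - (ℓ - ℓ') / 2) := by gcongr; linarith
  have hb1 : 1 < 1 + η * (ℓ - (ℓ - ℓ') / 2) := by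
    have : 0 < η * (ℓ - (ℓ - ℓ') / 2) := mul_pos hη (by linarith)
    linarith
  set a := 1 + η * ℓ' with ha
  set b := 1 + η * (ℓ - (ℓ - ℓ') / 2) with hb
  have ha1 : 1 ≤ a := by linarith
  have hlog : 0 < Real.log b := Real.log_pos hb1
  have hκ0 : 0 ≤ κ := by rw [hκ]; exact div_nonneg (Real.log_nonneg ha1) hlog.le
  have hκ1 : κ ≤ 1 := by
    rw [hκ]
    exact div_le_one_of_le₀ (Real.log_le_log (by linarith) hab) hlog.le
  have habκ : a = b ^ κ := by
    rw [Real.rpow_def_of_pos (by linarith), hκ, mul_div_cancel₀ _ hlog.ne',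
      Real.exp_log (by linarith)]
  set y := b ^ t with hy
  have hy1 : 1 ≤ y := one_le_pow₀ hb1.le
  have hat : a ^ t = y ^ κ := by
    rw [habκ, hy, ← Real.rpow_natCast, ← Real.rpow_natCast, ← Real.rpow_mul (by linarith),
      ← Real.rpow_mul (by linarith), mul_comm]
  have hΔ : 0 < ℓ - ℓ' := by linarith
  set Δ := ℓ - ℓ' with hΔdef
  have hq : 0 < √Δ := Real.sqrt_pos.2 hΔ
  have hys : y * s * 2 / √Δ ≤ 1 := by
    rw [div_le_one hq]
    refine Real.le_sqrt_of_sq_le ?_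
    rw [mul_pow]; linarith
  have hcL : c * √L = Δ / 8 * (2 ^ κ / √Δ ^ κ) := by
    have h1 : Δ ^ (κ / 2) = √Δ ^ κ := by
      rw [Real.sqrt_eq_rpow, ← Real.rpow_mul hΔ.le]; congr 1; ring
    have h2 : (2 : ℝ) ^ (3 : ℝ) = 8 := by norm_num
    have h3 : 0 < √L := Real.sqrt_pos.2 hL
    rw [hc, Real.rpow_sub hΔ, Real.rpow_sub two_pos, Real.rpow_one, h1, h2]
    have h4 : 0 < √Δ ^ κ := Real.rpow_pos_of_pos hq _
    have h5 : 0 < (2 : ℝ) ^ κ := Real.rpow_pos_of_pos two_pos _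
    field_simp
  have hyκ0 : 0 ≤ y ^ κ := Real.rpow_nonneg (by linarith) _
  have hyκ : y ^ κ ≤ y := by
    simpa using Real.rpow_le_rpow_of_exponent_le hy1 hκ1
  have hmul : y ^ κ * s ^ κ * (2 ^ κ / √Δ ^ κ) ≤ 1 := by
    rw [← Real.mul_rpow (by linarith) hs.le, ← mul_div_assoc,
      ← Real.mul_rpow (by positivity) two_pos.le, ← Real.div_rpow (by positivity) hq.le]
    exact Real.rpow_le_one (by positivity) hys hκ0
  calc (a ^ t * j) ^ 2 * √L = (y ^ κ) ^ 2 * j ^ 2 * √L := by rw [hat]; ring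
    _ ≤ (y ^ κ) ^ 2 * (c * s ^ ((1 : ℝ) + κ)) * √L := by gcongr
    _ = (y ^ κ * s ^ κ * (2 ^ κ / √Δ ^ κ)) * (Δ / 8 * s) * y ^ κ := by
      rw [Real.rpow_add hs, Real.rpow_one]
      linear_combination (y ^ κ) ^ 2 * s * s ^ κ * hcL
    _ ≤ 1 * (Δ / 8 * s) * y := by gcongr
    _ = _ := by ring

/-- Number of steps needed by the local phase to go below a given accuracy. -/
theorem local_steps_bound {x Δ L ε : ℝ} {r : ℕ} (hr : 0 < r) (hx0 : 0 < x) (hx1 : 36 * x ≤ 1)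
    (hΔ : 0 < Δ) (hL : 0 < L) (hε : 0 < ε) {n : ℕ}
    (hn : 8 * (1 / x * Real.log (200 * r * L ^ 2 / (x * Δ * ε))) ≤ n) :
    √r * ((1 - x / 8) ^ n * (12 * L ^ 2 / Δ)) ≤ ε := by
  have hr' : (1 : ℝ) ≤ r := by exact_mod_cast hr
  have hA : 0 < 200 * r * L ^ 2 / (x * Δ * ε) := by positivity
  have hpow : (1 - x / 8) ^ n ≤ (200 * r * L ^ 2 / (x * Δ * ε))⁻¹ := by
    calc (1 - x / 8) ^ n ≤ Real.exp (-(x / 8)) ^ n := by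
          gcongr
          · linarith
          · exact Real.one_sub_le_exp_neg _
      _ = Real.exp (-(x / 8 * n)) := by rw [← Real.exp_nat_mul]; congr 1; ring
      _ ≤ Real.exp (-Real.log (200 * r * L ^ 2 / (x * Δ * ε))) := by
          gcongr
          have := mul_le_mul_of_nonneg_left hn (show 0 ≤ x / 8 by linarith)
          refine le_trans (le_of_eq ?_) this
          field_simp
      _ = _ := by rw [Real.exp_neg, Real.exp_log hA]
  have hsr : √(r : ℝ) ≤ r := Real.sqrt_le_self_iff.2 (Or.inr hr')
  calc √(r : ℝ) * ((1 - x / 8) ^ n * (12 * L ^ 2 / Δ))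
      ≤ r * ((200 * r * L ^ 2 / (x * Δ * ε))⁻¹ * (12 * L ^ 2 / Δ)) := by
        have : 0 ≤ (1 - x / 8) ^ n := pow_nonneg (by linarith) _
        gcongr
    _ = 12 / 200 * x * ε := by field_simp
    _ ≤ 1 * ε := by gcongr; linarith
    _ = ε := one_mul ε

/-- When the accuracy is not trivial, the step budget covers both phases. -/
theorem step_budget {x Δ L ε T : ℝ} {r N t : ℕ} (hr : 0 < r) (hx0 : 0 < x) (hx1 : 36 * x ≤ 1)
    (hΔ : 0 < Δ) (hΔL : Δ ≤ L) (hε : 0 < ε) (hεL : ε < 3 * √r * L) (hT : 0 ≤ T)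
    (hN : (N : ℝ) ≤ 1 + 2 * T)
    (ht : 16 * (T + 1 / x * Real.log (200 * r * L ^ 2 / (x * Δ * ε))) ≤ t) :
    ∃ n : ℕ, t = N + n ∧ 8 * (1 / x * Real.log (200 * r * L ^ 2 / (x * Δ * ε))) ≤ n := by
  have hr' : (1 : ℝ) ≤ r := by exact_mod_cast hr
  have hL : 0 < L := hΔ.trans_le hΔL
  have hsr : √(r : ℝ) ≤ r := Real.sqrt_le_self_iff.2 (Or.inr hr')
  have hA : 3 ≤ 200 * r * L ^ 2 / (x * Δ * ε) := by
    rw [le_div_iff₀ (by positivity)]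
    calc 3 * (x * Δ * ε) ≤ 3 * (1 * L * (3 * r * L)) := by
          gcongr
          · linarith
          · refine hεL.le.trans ?_
            gcongr
      _ ≤ _ := by nlinarith [mul_pos (mul_pos hL hL) (zero_lt_one.trans_le hr')]
  have hlog : 1 ≤ Real.log (200 * r * L ^ 2 / (x * Δ * ε)) := by
    rw [Real.le_log_iff_exp_le (by linarith)]
    linarith [Real.exp_one_lt_three]
  have hS : 36 ≤ 1 / x * Real.log (200 * r * L ^ 2 / (x * Δ * ε)) := by
    have : 36 ≤ 1 / x := by rw [le_div_iff₀ hx0]; exact hx1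
    nlinarith
  have hNt : N ≤ t := by
    have : (N : ℝ) ≤ t := by linarith
    exact_mod_cast this
  refine ⟨t - N, by omega, ?_⟩
  rw [Nat.cast_sub hNt]
  linarith

end Scalars

section Matrices

open scoped RealInnerProductSpace InnerProductSpace

/-- The operator between Euclidean spaces attached to a real matrix. -/
noncomputable def euclideanOp {m n : ℕ} (M : Matrix (Fin m) (Fin n) ℝ) :
    EuclideanSpace ℝ (Fin n) →L[ℝ] EuclideanSpace ℝ (Fin m) :=
  LinearMap.toContinuousLinearMap (Matrix.toEuclideanLin M)

variable {l m n : ℕ}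

theorem euclideanOp_apply_ofLp (M : Matrix (Fin m) (Fin n) ℝ) (v : EuclideanSpace ℝ (Fin n)) :
    (euclideanOp M v).ofLp = M *ᵥ v.ofLp := rfl

theorem euclideanOp_add (M N : Matrix (Fin m) (Fin n) ℝ) :
    euclideanOp (M + N) = euclideanOp M + euclideanOp N := by
  simp [euclideanOp]

theorem euclideanOp_sub (M N : Matrix (Fin m) (Fin n) ℝ) :
    euclideanOp (M - N) = euclideanOp M - euclideanOp N := by
  simp [euclideanOp]

theorem euclideanOp_smul (c : ℝ) (M : Matrix (Fin m) (Fin n) ℝ) :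
    euclideanOp (c • M) = c • euclideanOp M := by
  simp [euclideanOp]

theorem euclideanOp_mul (M : Matrix (Fin l) (Fin m) ℝ) (N : Matrix (Fin m) (Fin n) ℝ) :
    euclideanOp (M * N) = euclideanOp M ∘L euclideanOp N := by
  ext v : 1
  refine WithLp.ofLp_injective 2 ?_
  rw [ContinuousLinearMap.comp_apply, euclideanOp_apply_ofLp, euclideanOp_apply_ofLp,
    euclideanOp_apply_ofLp, Matrix.mulVec_mulVec]

theorem inner_euclideanOp (M : Matrix (Fin m) (Fin n) ℝ) (v : EuclideanSpace ℝ (Fin n))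
    (w : EuclideanSpace ℝ (Fin m)) : ⟪euclideanOp M v, w⟫_ℝ = ⟪v, euclideanOp Mᵀ w⟫_ℝ := by
  rw [EuclideanSpace.inner_eq_star_dotProduct, EuclideanSpace.inner_eq_star_dotProduct,
    euclideanOp_apply_ofLp, euclideanOp_apply_ofLp]
  simp only [star_trivial]
  rw [Matrix.mulVec_transpose, Matrix.dotProduct_mulVec]

theorem euclideanOp_transpose (M : Matrix (Fin m) (Fin n) ℝ) :
    euclideanOp Mᵀ = (euclideanOp M).adjoint := by
  rw [ContinuousLinearMap.eq_adjoint_iff]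
  intro x y
  rw [inner_euclideanOp, Matrix.transpose_transpose]

theorem norm_sq_euclideanOp (M : Matrix (Fin m) (Fin n) ℝ) (v : EuclideanSpace ℝ (Fin n)) :
    ‖euclideanOp M v‖ ^ 2 = ∑ i, (M *ᵥ v.ofLp) i ^ 2 := by
  rw [EuclideanSpace.real_norm_sq_eq]
  rfl

theorem norm_euclideanOp_le_sigmaMax (M : Matrix (Fin m) (Fin n) ℝ)
    (v : EuclideanSpace ℝ (Fin n)) : ‖euclideanOp M v‖ ≤ sigmaMax M * ‖v‖ := by
  rcases eq_or_ne v 0 with rfl | hv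
  · simp
  have hn : 0 < ‖v‖ := norm_pos_iff.2 hv
  rw [← div_le_iff₀ hn]
  refine le_csSup ⟨‖euclideanOp M‖, ?_⟩ ⟨‖v‖⁻¹ • v, norm_smul_inv_norm hv, ?_⟩
  · rintro _ ⟨w, hw, rfl⟩
    exact (euclideanOp M).unit_le_opNorm w hw.le
  · change _ = ‖euclideanOp M (‖v‖⁻¹ • v)‖
    rw [map_smul, norm_smul, norm_inv, norm_norm, div_eq_inv_mul]

theorem sigmaMax_nonneg (M : Matrix (Fin m) (Fin n) ℝ) : 0 ≤ sigmaMax M := by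
  refine Real.sSup_nonneg ?_
  rintro _ ⟨w, -, rfl⟩
  exact norm_nonneg _

theorem sigmaMin_nonneg (M : Matrix (Fin m) (Fin n) ℝ) : 0 ≤ sigmaMin M := by
  refine Real.sInf_nonneg ?_
  rintro _ ⟨w, -, rfl⟩
  exact norm_nonneg _

theorem sigmaMin_mul_norm_le (M : Matrix (Fin m) (Fin n) ℝ)
    (v : EuclideanSpace ℝ (Fin n)) : sigmaMin M * ‖v‖ ≤ ‖euclideanOp M v‖ := by
  rcases eq_or_ne v 0 with rfl | hv
  · simp
  have hn : 0 < ‖v‖ := norm_pos_iff.2 hv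
  rw [← le_div_iff₀ hn]
  refine csInf_le ⟨0, ?_⟩ ⟨‖v‖⁻¹ • v, norm_smul_inv_norm hv, ?_⟩
  · rintro _ ⟨w, hw, rfl⟩
    exact norm_nonneg _
  · change _ = ‖euclideanOp M (‖v‖⁻¹ • v)‖
    rw [map_smul, norm_smul, norm_inv, norm_norm, div_eq_inv_mul]

theorem norm_euclideanOp_diagonal_le {μ : Fin n → ℝ} {c : ℝ} (hc : 0 ≤ c) (h0 : ∀ i, 0 ≤ μ i)
    (hμ : ∀ i, μ i ≤ c) : ‖euclideanOp (Matrix.diagonal μ)‖ ≤ c := by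
  refine ContinuousLinearMap.opNorm_le_bound _ hc fun v => ?_
  refine (sq_le_sq₀ (norm_nonneg _) (by positivity)).1 ?_
  rw [norm_sq_euclideanOp, mul_pow, EuclideanSpace.real_norm_sq_eq, Finset.mul_sum]
  refine Finset.sum_le_sum fun i _ => ?_
  rw [Matrix.mulVec_diagonal, mul_pow]
  have := pow_le_pow_left₀ (h0 i) (hμ i) 2
  gcongr

theorem inner_euclideanOp_diagonal_ge {μ : Fin n → ℝ} {c : ℝ} (hμ : ∀ i, c ≤ μ i)
    (v : EuclideanSpace ℝ (Fin n)) :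
    c * ‖v‖ ^ 2 ≤ ⟪euclideanOp (Matrix.diagonal μ) v, v⟫_ℝ := by
  rw [EuclideanSpace.real_norm_sq_eq, Finset.mul_sum, PiLp.inner_apply]
  refine Finset.sum_le_sum fun i _ => ?_
  rw [euclideanOp_apply_ofLp, Matrix.mulVec_diagonal]
  have := mul_le_mul_of_nonneg_right (hμ i) (sq_nonneg (v.ofLp i))
  simp only [RCLike.inner_apply, conj_trivial]
  linarith

/-- The squared Frobenius norm of a product. -/
theorem sum_sq_mul_le (M : Matrix (Fin l) (Fin m) ℝ) (N : Matrix (Fin m) (Fin n) ℝ) :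
    ∑ i, ∑ j, (M * N) i j ^ 2 ≤ ‖euclideanOp M‖ ^ 2 * ∑ i, ∑ j, N i j ^ 2 := by
  rw [Finset.sum_comm, Finset.sum_comm (f := fun i j => N i j ^ 2), Finset.mul_sum]
  refine Finset.sum_le_sum fun j _ => ?_
  have h := pow_le_pow_left₀ (norm_nonneg _)
    ((euclideanOp M).le_opNorm (WithLp.toLp 2 fun k => N k j)) 2
  rw [mul_pow, norm_sq_euclideanOp, EuclideanSpace.real_norm_sq_eq] at h
  exact h

theorem sum_sq_le (M : Matrix (Fin m) (Fin n) ℝ) :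
    ∑ i, ∑ j, M i j ^ 2 ≤ n * ‖euclideanOp M‖ ^ 2 := by
  have h := sum_sq_mul_le M (1 : Matrix (Fin n) (Fin n) ℝ)
  have h1 : ∑ i : Fin n, ∑ j : Fin n, (1 : Matrix (Fin n) (Fin n) ℝ) i j ^ 2 = n := by
    simp [Matrix.one_apply]
  rw [Matrix.mul_one, h1, mul_comm] at h
  exact h

theorem Fin.sum_eq_add_of_add_eq {d r k : ℕ} (hd : r + k = d) (f : Fin d → ℝ) :
    ∑ i, f i = ∑ i : Fin r, f (Fin.castLE (by omega) i) +
      ∑ i : Fin k, f ⟨r + (i : ℕ), by have := i.isLt; omega⟩ := by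
  subst hd
  exact Fin.sum_univ_add f

theorem Fin.sum_eq_add_sub {d r : ℕ} (h : r ≤ d) (f : Fin d → ℝ) :
    ∑ i, f i = ∑ i : Fin r, f (Fin.castLE h i) +
      ∑ i : Fin (d - r), f ⟨r + (i : ℕ), by have := i.isLt; omega⟩ :=
  Fin.sum_eq_add_of_add_eq (Nat.add_sub_cancel' h) f

variable {d r : ℕ}

theorem norm_sq_euclideanOp_blocks (h : r ≤ d) (X : Matrix (Fin d) (Fin r) ℝ)
    (v : EuclideanSpace ℝ (Fin r)) :
    ‖euclideanOp X v‖ ^ 2 =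
      ‖euclideanOp (topBlock h X) v‖ ^ 2 + ‖euclideanOp (botBlock X) v‖ ^ 2 := by
  rw [norm_sq_euclideanOp, norm_sq_euclideanOp, norm_sq_euclideanOp, Fin.sum_eq_add_sub h]
  rfl

theorem transpose_mul_self_blocks (h : r ≤ d) (X : Matrix (Fin d) (Fin r) ℝ) :
    Xᵀ * X = (topBlock h X)ᵀ * topBlock h X + (botBlock X)ᵀ * botBlock X := by
  ext i j
  rw [Matrix.add_apply, Matrix.mul_apply, Matrix.mul_apply, Matrix.mul_apply,
    Fin.sum_eq_add_sub h]
  rfl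

/-- One step of gradient descent on the top block. -/
theorem topBlock_gdIter_succ (h : r ≤ d) (lam : Fin d → ℝ) (η : ℝ)
    (X0 : Matrix (Fin d) (Fin r) ℝ) (t : ℕ) :
    let X := gdIter (Matrix.diagonal lam) η X0
    topBlock h (X (t + 1)) = topBlock h (X t) +
      η • (Matrix.diagonal (fun i => lam (Fin.castLE h i)) * topBlock h (X t) -
        topBlock h (X t) * ((topBlock h (X t))ᵀ * topBlock h (X t) +
          (botBlock (X t))ᵀ * botBlock (X t))) := by
  intro X
  have hX : X (t + 1) = X t + η • (Matrix.diagonal lam * X t - X t * ((X t)ᵀ * X t)) := by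
    rw [← Matrix.mul_assoc, ← Matrix.sub_mul]
    rfl
  rw [← transpose_mul_self_blocks, hX]
  ext i j
  simp only [topBlock, Matrix.add_apply, Matrix.smul_apply, Matrix.sub_apply,
    Matrix.diagonal_mul, Matrix.mul_apply (N := (X t)ᵀ * X t)]

/-- One step of gradient descent on the bottom block. -/
theorem botBlock_gdIter_succ (h : r ≤ d) (lam : Fin d → ℝ) (η : ℝ)
    (X0 : Matrix (Fin d) (Fin r) ℝ) (t : ℕ) :
    let X := gdIter (Matrix.diagonal lam) η X0
    botBlock (X (t + 1)) = botBlock (X t) +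
      η • (Matrix.diagonal (fun i : Fin (d - r) => lam ⟨r + i, by have := i.isLt; omega⟩) *
          botBlock (X t) -
        botBlock (X t) * ((topBlock h (X t))ᵀ * topBlock h (X t) +
          (botBlock (X t))ᵀ * botBlock (X t))) := by
  intro X
  have hX : X (t + 1) = X t + η • (Matrix.diagonal lam * X t - X t * ((X t)ᵀ * X t)) := by
    rw [← Matrix.mul_assoc, ← Matrix.sub_mul]
    rfl
  rw [← transpose_mul_self_blocks, hX]
  ext i j
  simp only [botBlock, Matrix.add_apply, Matrix.smul_apply, Matrix.sub_apply,
    Matrix.diagonal_mul, Matrix.mul_apply (N := (X t)ᵀ * X t)]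

theorem isBlockDescent_gdIter (h : r ≤ d) (lam : Fin d → ℝ) (η : ℝ)
    (X0 : Matrix (Fin d) (Fin r) ℝ) :
    IsBlockDescent (euclideanOp (Matrix.diagonal fun i => lam (Fin.castLE h i)))
      (euclideanOp (Matrix.diagonal fun i : Fin (d - r) =>
        lam ⟨r + i, by have := i.isLt; omega⟩)) η
      (fun t => euclideanOp (topBlock h (gdIter (Matrix.diagonal lam) η X0 t)))
      (fun t => euclideanOp (botBlock (gdIter (Matrix.diagonal lam) η X0 t))) where
  top t := by
    rw [topBlock_gdIter_succ]
    simp only [euclideanOp_add, euclideanOp_smul, euclideanOp_sub, euclideanOp_mul,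
      euclideanOp_transpose, blockStep, stackedGram]
  bot t := by
    rw [botBlock_gdIter_succ h]
    simp only [euclideanOp_add, euclideanOp_smul, euclideanOp_sub, euclideanOp_mul,
      euclideanOp_transpose, blockStep, stackedGram]

/-- Frobenius error bound in terms of the operator norms of the blocks. -/
theorem frobNorm_sq_le_blocks (h : r ≤ d) (lam : Fin d → ℝ) (X : Matrix (Fin d) (Fin r) ℝ)
    {L : ℝ} (hU : ‖euclideanOp (topBlock h X)‖ ^ 2 ≤ L)
    (hJ : ‖euclideanOp (botBlock X)‖ ^ 2 ≤ L) :
    frobNorm (Matrix.diagonal (fun i : Fin d => if (i : ℕ) < r then lam i else 0) - X * Xᵀ) ^ 2 ≤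
      r * (‖euclideanOp (topBlock h X) * star (euclideanOp (topBlock h X)) -
        euclideanOp (Matrix.diagonal fun i => lam (Fin.castLE h i))‖ ^ 2 +
        3 * L * ‖euclideanOp (botBlock X)‖ ^ 2) := by
  set U := topBlock h X with hUdef
  set J := botBlock X with hJdef
  set D := Matrix.diagonal fun i => lam (Fin.castLE h i) with hD
  have htr : ∑ i, ∑ j, Jᵀ i j ^ 2 ≤ r * ‖euclideanOp J‖ ^ 2 := by
    rw [Finset.sum_comm]
    exact sum_sq_le J
  have h1 := sum_sq_le (U * Uᵀ - D)
  have h2 := sum_sq_mul_le U Jᵀ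
  have h4 := sum_sq_mul_le J Jᵀ
  have h3 : ∑ i, ∑ j, (J * Uᵀ) i j ^ 2 = ∑ i, ∑ j, (U * Jᵀ) i j ^ 2 := by
    rw [Finset.sum_comm]
    refine Finset.sum_congr rfl fun i _ => Finset.sum_congr rfl fun j _ => ?_
    rw [← Matrix.transpose_apply (J * Uᵀ), Matrix.transpose_mul, Matrix.transpose_transpose]
  have hop : euclideanOp (U * Uᵀ - D) =
      euclideanOp U * star (euclideanOp U) - euclideanOp D := by
    rw [euclideanOp_sub, euclideanOp_mul, euclideanOp_transpose]
    rfl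
  rw [hop] at h1
  have hsplit : frobNorm
      (Matrix.diagonal (fun i : Fin d => if (i : ℕ) < r then lam i else 0) - X * Xᵀ) ^ 2 =
      ∑ i, ∑ j, (U * Uᵀ - D) i j ^ 2 + ∑ i, ∑ j, (U * Jᵀ) i j ^ 2 +
        (∑ i, ∑ j, (J * Uᵀ) i j ^ 2 + ∑ i, ∑ j, (J * Jᵀ) i j ^ 2) := by
    rw [frobNorm, Real.sq_sqrt (by positivity), Fin.sum_eq_add_sub h]
    simp only [Fin.sum_eq_add_sub h (fun j => _ ^ 2), Finset.sum_add_distrib]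
    congr 2
    · refine Finset.sum_congr rfl fun i _ => Finset.sum_congr rfl fun j _ => ?_
      rw [Matrix.sub_apply, Matrix.sub_apply, ← neg_sq, neg_sub]
      simp [hD, hUdef, topBlock, Matrix.mul_apply, Matrix.diagonal_apply]
    · refine Finset.sum_congr rfl fun i _ => Finset.sum_congr rfl fun j _ => ?_
      have : Fin.castLE h i ≠ ⟨r + j, by have := j.isLt; omega⟩ := by
        intro e; have := congrArg Fin.val e; have := i.isLt; simp at *; omega
      simp [hUdef, hJdef, topBlock, botBlock, Matrix.mul_apply, this]
    · refine Finset.sum_congr rfl fun i _ => Finset.sum_congr rfl fun j _ => ?_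
      simp [hUdef, hJdef, topBlock, botBlock, Matrix.mul_apply, Matrix.diagonal_apply]
    · refine Finset.sum_congr rfl fun i _ => Finset.sum_congr rfl fun j _ => ?_
      simp [hJdef, botBlock, Matrix.mul_apply, Matrix.diagonal_apply]
  rw [hsplit, h3]
  have hr0 : (0 : ℝ) ≤ r := by positivity
  have hS : 0 ≤ ∑ i, ∑ j, Jᵀ i j ^ 2 := by positivity
  have hL : 0 ≤ L := (sq_nonneg _).trans hU
  have a1 := mul_le_mul_of_nonneg_right hU hS
  have a2 := mul_le_mul_of_nonneg_right hJ hS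
  have a3 := mul_le_mul_of_nonneg_left htr hL
  linarith

end Matrices

/-- Theorem B.1 (and Theorem 3.2): fast global convergence of gradient descent under
the small-initialization condition (Condition 1). -/
theorem small_init_global_convergence :
    ∃ C : ℝ, 0 < C ∧
      ∀ (d r : ℕ), 0 < r → ∀ (hrd : r < d) (lam : Fin d → ℝ),
        (∀ i j : Fin d, i ≤ j → lam j ≤ lam i) →
        (∀ i, 0 ≤ lam i) →
        ∀ η : ℝ, 0 < η →
        0 < lam ⟨r - 1, by omega⟩ - lam ⟨r, hrd⟩ →
        η ≤ (lam ⟨r - 1, by omega⟩ - lam ⟨r, hrd⟩) ^ 2 / (36 * lam ⟨0, by omega⟩ ^ 3) →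
        ∀ κ c1 : ℝ,
        κ = Real.log (1 + η * lam ⟨r, hrd⟩) /
              Real.log (1 + η * (lam ⟨r - 1, by omega⟩ -
                (lam ⟨r - 1, by omega⟩ - lam ⟨r, hrd⟩) / 2)) →
        c1 = (lam ⟨r - 1, by omega⟩ - lam ⟨r, hrd⟩) ^ ((1 : ℝ) - κ / 2) /
              (2 ^ ((3 : ℝ) - κ) * Real.sqrt (lam ⟨0, by omega⟩)) →
        ∀ X0 : Matrix (Fin d) (Fin r) ℝ,
        sigmaMax X0 ^ 2 ≤ lam ⟨0, by omega⟩ →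
        sigmaMax (botBlock X0) ^ 2 ≤
          lam ⟨r - 1, by omega⟩ - (lam ⟨r - 1, by omega⟩ - lam ⟨r, hrd⟩) / 2 →
        0 < sigmaMin (topBlock hrd.le X0) ^ 2 →
        sigmaMin (topBlock hrd.le X0) ^ 2 < (lam ⟨r - 1, by omega⟩ - lam ⟨r, hrd⟩) / 4 →
        sigmaMax (botBlock X0) ^ 2 ≤ c1 * sigmaMin (topBlock hrd.le X0) ^ ((1 : ℝ) + κ) →
        ∀ ε : ℝ, 0 < ε → ∀ t : ℕ,
          C * ((1 / (η * (lam ⟨r - 1, by omega⟩ - lam ⟨r, hrd⟩))) *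
                Real.log ((lam ⟨r - 1, by omega⟩ - lam ⟨r, hrd⟩) /
                  (4 * sigmaMin (topBlock hrd.le X0) ^ 2)) +
              (1 / (η * (lam ⟨r - 1, by omega⟩ - lam ⟨r, hrd⟩))) *
                Real.log (200 * r * lam ⟨0, by omega⟩ ^ 2 /
                  (η * (lam ⟨r - 1, by omega⟩ - lam ⟨r, hrd⟩) ^ 2 * ε))) ≤ (t : ℝ) →
          frobNorm
            (Matrix.diagonal (fun i : Fin d => if (i : ℕ) < r then lam i else 0) -
              gdIter (Matrix.diagonal lam) η X0 t * (gdIter (Matrix.diagonal lam) η X0 t)ᵀ)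
            ≤ ε := by
  refine ⟨16, by norm_num, ?_⟩
  intro d r hr hrd lam hanti hnn η hη hgap hηle κ c1 hκ hc1 X0 hX0 _ hs0 hsΔ hj ε hε t ht
  have hΔL : lam ⟨r - 1, by omega⟩ ≤ lam ⟨0, by omega⟩ := hanti _ _ (Nat.zero_le _)
  have hℓ' : 0 ≤ lam ⟨r, hrd⟩ := hnn _
  have hbot : ∀ i : Fin (d - r), lam ⟨r + i, by have := i.isLt; omega⟩ ≤ lam ⟨r, hrd⟩ :=
    fun i => hanti _ _ (Nat.le_add_right _ _)
  have htop : ∀ i : Fin r, lam ⟨r - 1, by omega⟩ ≤ lam (Fin.castLE hrd.le i) :=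
    fun i => hanti _ _ (Nat.le_sub_one_of_lt i.isLt)
  have htop' : ∀ i : Fin r, lam (Fin.castLE hrd.le i) ≤ lam ⟨0, by omega⟩ :=
    fun i => hanti _ _ (Nat.zero_le _)
  set ℓ' := lam ⟨r, hrd⟩
  set ℓ := lam ⟨r - 1, by omega⟩
  set L := lam ⟨0, by omega⟩
  have hL : 0 < L := by linarith
  have h : GapAssumptions (euclideanOp (Matrix.diagonal fun i => lam (Fin.castLE hrd.le i)))
      (euclideanOp (Matrix.diagonal fun i : Fin (d - r) =>
        lam ⟨r + i, by have := i.isLt; omega⟩)) η L ℓ ℓ' :=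
    { eta_pos := hη
      nonneg := hℓ'
      gap := by linarith
      le_max := hΔL
      eta_le := by
        rw [le_div_iff₀ (by positivity)] at hηle
        refine le_of_mul_le_mul_right ?_ hL
        calc 36 * (η * L ^ 2) * L = η * (36 * L ^ 3) := by ring
          _ ≤ (ℓ - ℓ') ^ 2 := hηle
          _ = (ℓ - ℓ') * (ℓ - ℓ') := sq _
          _ ≤ (ℓ - ℓ') * L := by gcongr; linarith
      lower := inner_euclideanOp_diagonal_ge htop
      norm_le := norm_euclideanOp_diagonal_le hL.le (fun _ => hnn _) htop'
      adjoint_eq := by rw [← euclideanOp_transpose, Matrix.diagonal_transpose]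
      norm_le' := norm_euclideanOp_diagonal_le hℓ' (fun _ => hnn _) hbot
      lower' := fun w => by
        simpa using inner_euclideanOp_diagonal_ge (c := 0) (fun _ => hnn _) w }
  have hd := isBlockDescent_gdIter hrd.le lam η X0
  have hX : ∀ v, ‖euclideanOp (topBlock hrd.le X0) v‖ ^ 2 + ‖euclideanOp (botBlock X0) v‖ ^ 2 ≤
      L * ‖v‖ ^ 2 := fun v => by
    rw [← norm_sq_euclideanOp_blocks]
    refine (pow_le_pow_left₀ (norm_nonneg _) (norm_euclideanOp_le_sigmaMax X0 v) 2).trans ?_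
    rw [mul_pow]
    gcongr
  set s := sigmaMin (topBlock hrd.le X0) with hsdef
  have hs : 0 < s :=
    lt_of_le_of_ne' (sigmaMin_nonneg _) ((pow_ne_zero_iff two_ne_zero).1 hs0.ne')
  have hJ0 : ‖euclideanOp (botBlock X0)‖ ≤ sigmaMax (botBlock X0) :=
    ContinuousLinearMap.opNorm_le_bound _ (sigmaMax_nonneg _) (norm_euclideanOp_le_sigmaMax _)
  obtain ⟨N, hN, hJN, hUN⟩ := h.exists_end_of_growth hd hX hs hsΔ (sigmaMin_mul_norm_le _) hJ0
    (growth_ratio_bound hη hL hℓ' h.gap hs hκ hc1 hj)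
  have hUL := opNorm_sq_le_of_sq_le hL.le fun v =>
    le_trans (le_add_of_nonneg_right (sq_nonneg _)) (h.norm_sq_le hd hX t v)
  have hJL := opNorm_sq_le_of_sq_le hL.le fun v =>
    le_trans (le_add_of_nonneg_left (sq_nonneg _)) (h.norm_sq_le hd hX t v)
  have hfrob := frobNorm_sq_le_blocks hrd.le lam (gdIter (Matrix.diagonal lam) η X0 t) hUL hJL
  have hx0 : 0 < η * (ℓ - ℓ') := mul_pos hη hgap
  rcases le_or_gt (3 * √r * L) ε with hεL | hεL
  · refine le_trans (abs_le_of_sq_le_sq' (hfrob.trans ?_) (by positivity)).2 hεL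
    have he := pow_le_pow_left₀ (norm_nonneg _) (h.norm_mul_star_sub_le (h.norm_sq_le hd hX t)) 2
    have h2 := mul_le_mul_of_nonneg_left hJL (show 0 ≤ 3 * L by positivity)
    have e1 : (3 * √r * L) ^ 2 = r * (9 * L ^ 2) := by
      rw [mul_pow, mul_pow, Real.sq_sqrt (Nat.cast_nonneg r)]
      ring
    rw [e1]
    refine mul_le_mul_of_nonneg_left ?_ (Nat.cast_nonneg r)
    nlinarith
  · have hlogs : 0 ≤ 1 / (η * (ℓ - ℓ')) * Real.log ((ℓ - ℓ') / (4 * s ^ 2)) := by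
      refine mul_nonneg (by positivity) (Real.log_nonneg ?_)
      rw [one_le_div (by positivity)]
      linarith
    have hden : η * (ℓ - ℓ') ^ 2 * ε = η * (ℓ - ℓ') * (ℓ - ℓ') * ε := by ring
    rw [hden] at ht
    obtain ⟨n, rfl, hn⟩ := step_budget hr hx0 h.eta_gap_le hgap (by linarith) hε hεL hlogs hN ht
    refine le_trans ?_ (local_steps_bound hr hx0 h.eta_gap_le hgap hL hε hn)
    obtain ⟨he, hJ⟩ := h.local_convergence hd hX hJN hUN n
    have hk : 0 ≤ (1 - η * (ℓ - ℓ') / 8) ^ n :=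
      pow_nonneg (by linarith [h.eta_gap_le]) _
    set k := (1 - η * (ℓ - ℓ') / 8) ^ n
    refine (abs_le_of_sq_le_sq' (hfrob.trans ?_) (by positivity)).2
    have he2 := pow_le_pow_left₀ (norm_nonneg _) he 2
    have hJ2 := pow_le_pow_left₀ (norm_nonneg _) hJ 2
    rw [mul_pow k √L, Real.sq_sqrt hL.le] at hJ2
    have hJ3 := mul_le_mul_of_nonneg_left hJ2 (show 0 ≤ 3 * L by positivity)
    have hLΔ : L ≤ L ^ 2 / (ℓ - ℓ') := by
      rw [le_div_iff₀ hgap, sq]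
      gcongr
      linarith
    have hL2 := pow_le_pow_left₀ hL.le hLΔ 2
    have hkL := mul_le_mul_of_nonneg_left hL2 (sq_nonneg k)
    have hB : 0 ≤ k ^ 2 * (L ^ 2 / (ℓ - ℓ')) ^ 2 := by positivity
    rw [mul_pow, Real.sq_sqrt (Nat.cast_nonneg r)]
    refine mul_le_mul_of_nonneg_left ?_ (Nat.cast_nonneg r)
    have e1 : (k * (10 * L ^ 2 / (ℓ - ℓ'))) ^ 2 = 100 * (k ^ 2 * (L ^ 2 / (ℓ - ℓ')) ^ 2) := by ring
    have e2 : (k * (12 * L ^ 2 / (ℓ - ℓ'))) ^ 2 = 144 * (k ^ 2 * (L ^ 2 / (ℓ - ℓ')) ^ 2) := by ring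
    rw [e2]
    rw [e1] at he2
    linarith
end
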